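/- Let F_q be a finite field of odd cardinality q. Let n be a natural number, and let A be a nonzero polynomial in F_q[t] of degree smaller than n. Then there exists s₀ such that for every s ≥ s₀ and every finite field K containing F_q with #K = q^s, there is a monic polynomial P ∈ K[t] of degree n for which both P and P + A (viewing A in K[t]) are irreducible over K. -/

import Mathlib

open Polynomial

namespace TwinPrimes

section Stepanov

variable {K : Type*} [Field K]

lemma finrank_degreeLT (d : ℕ) : Module.finrank K (degreeLT K d) = d := by
  rw [(degreeLTEquiv K d).finrank_eq, Module.finrank_fin_fun]

lemma finite_degreeLT (d : ℕ) : Module.Finite K (degreeLT K d) :=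
  Module.Finite.equiv (degreeLTEquiv K d).symm

lemma mul_mem_degreeLT {p r : K[X]} {a d : ℕ} (hp : p.natDegree ≤ a) (hr : r ∈ degreeLT K d) :
    p * r ∈ degreeLT K (a + d) := by
  rw [mem_degreeLT] at hr ⊢
  by_cases hp0 : p = 0
  · simp [hp0]
  by_cases hr0 : r = 0
  · simp [hr0]
  rw [← natDegree_lt_iff_degree_lt hr0] at hr
  rw [← natDegree_lt_iff_degree_lt (mul_ne_zero hp0 hr0), natDegree_mul hp0 hr0]
  omega

lemma hasseDeriv_mem_degreeLT {r : K[X]} {d : ℕ} (j : ℕ) (hr : r ∈ degreeLT K d) :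
    hasseDeriv j r ∈ degreeLT K d := by
  rw [mem_degreeLT, degree_lt_iff_coeff_zero] at hr ⊢
  intro m hm
  rw [hasseDeriv_coeff, hr _ (by omega), mul_zero]

lemma pow_sub_dvd_hasseDeriv_pow (f : K[X]) (N i : ℕ) : f ^ (N - i) ∣ hasseDeriv i (f ^ N) := by
  induction N generalizing i with
  | zero => simp
  | succ N ih =>
    rw [pow_succ', hasseDeriv_mul]
    refine Finset.dvd_sum fun ij hij => ?_
    obtain ⟨a, b⟩ := ij
    rw [Finset.HasAntidiagonal.mem_antidiagonal] at hij
    simp only at hij ⊢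
    rcases Nat.eq_zero_or_pos a with rfl | ha
    · obtain rfl : b = i := by omega
      rw [hasseDeriv_zero']
      refine (pow_dvd_pow f (show N + 1 - b ≤ (N - b) + 1 by omega)).trans ?_
      rw [pow_succ']
      exact mul_dvd_mul_left _ (ih b)
    · exact ((pow_dvd_pow f (by omega)).trans (ih b)).mul_left _

/-- Up to the power `f ^ (N - k)`, the `k`-th Hasse derivative of `f ^ N * r` depends linearly
on `r`, with a bounded growth of degree. -/
lemma exists_hasseDeriv_pow_mul {f : K[X]} (hf : f ≠ 0) {N k : ℕ} (hk : k ≤ N) :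
    ∃ T : K[X] →ₗ[K] K[X], (∀ r, hasseDeriv k (f ^ N * r) = f ^ (N - k) * T r) ∧
      ∀ d, ∀ r ∈ degreeLT K d, T r ∈ degreeLT K (k * f.natDegree + d) := by
  choose U hU using pow_sub_dvd_hasseDeriv_pow f N
  refine ⟨∑ ij ∈ Finset.HasAntidiagonal.antidiagonal k,
    (LinearMap.mulLeft K (f ^ (k - ij.1) * U ij.1)) ∘ₗ hasseDeriv ij.2, ?_, ?_⟩
  · intro r
    rw [hasseDeriv_mul, LinearMap.sum_apply, Finset.mul_sum]
    refine Finset.sum_congr rfl fun ij hij => ?_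
    rw [Finset.HasAntidiagonal.mem_antidiagonal] at hij
    rw [hU, LinearMap.comp_apply, LinearMap.mulLeft_apply,
      show N - ij.1 = (N - k) + (k - ij.1) by omega, pow_add]
    ring
  · intro d r hr
    rw [LinearMap.sum_apply]
    refine Submodule.sum_mem _ fun ij hij => ?_
    rw [Finset.HasAntidiagonal.mem_antidiagonal] at hij
    rw [LinearMap.comp_apply, LinearMap.mulLeft_apply]
    refine mul_mem_degreeLT ?_ (hasseDeriv_mem_degreeLT _ hr)
    by_cases hU0 : U ij.1 = 0
    · simp [hU0]
    have h1 : (hasseDeriv ij.1 (f ^ N)).natDegree ≤ N * f.natDegree := by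
      refine (natDegree_hasseDeriv_le _ _).trans ?_
      rw [natDegree_pow]
      omega
    rw [hU, natDegree_mul (pow_ne_zero _ hf) hU0, natDegree_pow] at h1
    rw [natDegree_mul (pow_ne_zero _ hf) hU0, natDegree_pow]
    have h2 : N * f.natDegree = (N - ij.1) * f.natDegree + ij.1 * f.natDegree := by
      rw [← add_mul]; congr 1; omega
    have h3 : k * f.natDegree = (k - ij.1) * f.natDegree + ij.1 * f.natDegree := by
      rw [← add_mul]; congr 1; omega
    omega

lemma X_sub_C_pow_dvd_iff_hasseDeriv {U : K[X]} {x : K} {l : ℕ}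
    (h : ∀ k < l, (hasseDeriv k U).eval x = 0) : (X - C x) ^ l ∣ U := by
  have h1 : X ^ l ∣ taylor x U := by
    rw [X_pow_dvd_iff]
    intro d hd
    rw [taylor_coeff, h d hd]
  obtain ⟨V, hV⟩ := h1
  have h2 := congrArg (fun p => (taylorEquiv x).symm p) hV
  have h3 : ∀ p, (taylorEquiv x) p = taylor x p := fun p => rfl
  rw [← h3] at h2
  simp only [AlgEquiv.symm_apply_apply, map_mul, map_pow] at h2
  have h4 : (taylorEquiv x).symm X = X - C x := by
    rw [AlgEquiv.symm_apply_eq, h3]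
    simp
  rw [h4] at h2
  exact ⟨_, h2⟩

lemma exists_stepanov_coefficients {f : K[X]} (hf : f ≠ 0) (e : ℕ) (a : K) {l J d : ℕ}
    (hdim : l * (J + (l * f.natDegree + d)) < J * (d + d)) :
    ∃ r s : Fin J → K[X], (∀ j, r j ∈ degreeLT K d) ∧ (∀ j, s j ∈ degreeLT K d) ∧
      (∃ j, r j ≠ 0 ∨ s j ≠ 0) ∧
      ∀ x, (f ^ e).eval x = a → ∀ k < l, (hasseDeriv k
        (∑ j : Fin J, C (x ^ (j : ℕ)) * (f ^ l * r j + f ^ (l + e) * s j))).eval x = 0 := by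
  have := finite_degreeLT (K := K)
  have H1 : ∀ k : Fin l, (k : ℕ) ≤ l := fun k => k.2.le
  have H2 : ∀ k : Fin l, (k : ℕ) ≤ l + e := fun k => k.2.le.trans (Nat.le_add_right _ _)
  choose T hT hTd using fun k : Fin l => exists_hasseDeriv_pow_mul hf (H1 k)
  choose T' hT' hTd' using fun k : Fin l => exists_hasseDeriv_pow_mul hf (H2 k)
  let V := Fin J → degreeLT K d × degreeLT K d
  let Ψ : Fin l → V →ₗ[K] K[X] := fun k => ∑ j : Fin J,
    (LinearMap.mulLeft K (X ^ (j : ℕ))) ∘ₗ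
      (T k ∘ₗ (degreeLT K d).subtype ∘ₗ LinearMap.fst K _ _ ∘ₗ LinearMap.proj j +
        a • (T' k ∘ₗ (degreeLT K d).subtype ∘ₗ LinearMap.snd K _ _ ∘ₗ LinearMap.proj j))
  have hΨ : ∀ k v, Ψ k v = ∑ j : Fin J, X ^ (j : ℕ) *
      (T k (v j).1 + a • T' k (v j).2) := by
    intro k v
    simp only [Ψ, LinearMap.sum_apply]
    rfl
  have hmem : ∀ k v, Ψ k v ∈ degreeLT K (J + (l * f.natDegree + d)) := by
    intro k v
    rw [hΨ]
    refine Submodule.sum_mem _ fun j _ => mul_mem_degreeLT (by simp [j.2.le]) ?_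
    have hle : k * f.natDegree + d ≤ l * f.natDegree + d := by gcongr; exact k.2.le
    refine degreeLT_mono hle ?_
    exact Submodule.add_mem _ (hTd k d _ (v j).1.2) (Submodule.smul_mem _ _ (hTd' k d _ (v j).2.2))
  let Φ : V →ₗ[K] (Fin l → degreeLT K (J + (l * f.natDegree + d))) :=
    LinearMap.pi fun k => (Ψ k).codRestrict _ (hmem k)
  have hker : LinearMap.ker Φ ≠ ⊥ := by
    apply LinearMap.ker_ne_bot_of_finrank_lt
    rw [Module.finrank_pi_fintype, Module.finrank_pi_fintype]
    simpa [Module.finrank_prod, finrank_degreeLT] using hdim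
  obtain ⟨v, hv, hv0⟩ := Submodule.exists_mem_ne_zero_of_ne_bot hker
  refine ⟨fun j => (v j).1, fun j => (v j).2, fun j => (v j).1.2, fun j => (v j).2.2, ?_, ?_⟩
  · by_contra! hcon
    apply hv0
    funext j
    have := hcon j
    exact Prod.ext (Subtype.ext this.1) (Subtype.ext this.2)
  · intro x hx k hk
    have h0 : Ψ ⟨k, hk⟩ v = 0 := by
      have := congrFun (LinearMap.mem_ker.1 hv) ⟨k, hk⟩
      exact congrArg Subtype.val this
    rw [hΨ] at h0
    have h1 := congrArg (eval x) h0
    rw [eval_finsetSum] at h1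
    rw [map_sum, eval_finsetSum]
    have h2 : ∀ j : Fin J, eval x (hasseDeriv k (C (x ^ (j : ℕ)) *
        (f ^ l * (v j).1 + f ^ (l + e) * (v j).2))) =
        eval x (f ^ (l - k)) * eval x (X ^ (j : ℕ) *
          (T ⟨k, hk⟩ (v j).1 + a • T' ⟨k, hk⟩ (v j).2)) := by
      intro j
      rw [← smul_eq_C_mul, map_smul, map_add, hT ⟨k, hk⟩, hT' ⟨k, hk⟩]
      have : l + e - k = (l - k) + e := by omega
      simp only [this, pow_add, eval_smul, eval_add, eval_mul, hx, smul_eq_mul, eval_X, eval_pow]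
      ring
    rw [Finset.sum_congr rfl fun j _ => h2 j, ← Finset.mul_sum, h1]
    simp

lemma eq_C_mul_sq_of_sq_mul_eq {f r s : K[X]} {c : K} (hf : ¬ ∃ c g, f = C c * g ^ 2)
    (h : r ^ 2 * f = C c * s ^ 2) : r = 0 := by
  by_contra hr
  have hdvd : r ^ 2 ∣ C c * s ^ 2 := ⟨f, h.symm⟩
  by_cases hc : c = 0
  · subst hc
    have : f = 0 := by
      have h3 : r ^ 2 * f = 0 := by rw [h]; simp
      simpa [hr] using h3
    exact hf ⟨0, 0, by simp [this]⟩
  have h2 : r ^ 2 ∣ s ^ 2 := by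
    have hu : IsUnit (C c) := isUnit_C.2 (isUnit_iff_ne_zero.2 hc)
    exact (hu.dvd_mul_left).1 hdvd
  obtain ⟨w, rfl⟩ := (UniqueFactorizationMonoid.pow_dvd_pow_iff_dvd two_ne_zero).1 h2
  refine hf ⟨c, w, mul_left_cancel₀ (pow_ne_zero 2 hr) ?_⟩
  rw [h]; ring

end Stepanov

section Stepanov

variable {K : Type*} [Field K] [Fintype K]

lemma X_pow_card_dvd_pow_card_sub (f : K[X]) :
    X ^ Fintype.card K ∣ f ^ Fintype.card K - C (f.eval 0) := by
  rw [← FiniteField.expand_card f]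
  have h : f - C (f.eval 0) = X * f.divX := by
    rw [← coeff_zero_eq_eval_zero, sub_eq_iff_eq_add]
    exact (X_mul_divX_add f).symm
  refine ⟨expand K (Fintype.card K) f.divX, ?_⟩
  have h2 := congrArg (expand K (Fintype.card K)) h
  rwa [map_sub, expand_C, map_mul, expand_X] at h2

lemma eq_zero_of_X_pow_card_dvd {f r s : K[X]} {e d : ℕ} (hq : Fintype.card K = 2 * e + 1)
    (hf : ¬ ∃ c g, f = C c * g ^ 2) (hf0 : f.eval 0 ≠ 0) (hd : 2 * d + f.natDegree ≤ 2 * e + 2)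
    (hr : r ∈ degreeLT K d) (hs : s ∈ degreeLT K d)
    (h : X ^ Fintype.card K ∣ r + s * f ^ e) : r = 0 ∧ s = 0 := by
  have hdvd : X ^ Fintype.card K ∣ r ^ 2 * f - C (f.eval 0) * s ^ 2 := by
    have h1 := (h.mul_right ((r - s * f ^ e) * f))
    have h2 := (X_pow_card_dvd_pow_card_sub f).mul_right (s ^ 2)
    convert dvd_add h1 h2 using 1
    rw [hq]
    ring
  have key : r ^ 2 * f = C (f.eval 0) * s ^ 2 := by
    rw [← sub_eq_zero]
    by_contra hne
    have h1 := natDegree_le_of_dvd hdvd hne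
    rw [natDegree_X_pow] at h1
    have hlt : ∀ p ∈ degreeLT K d, p ≠ 0 → p.natDegree < d := fun p hp hp0 => by
      rw [mem_degreeLT] at hp
      exact (natDegree_lt_iff_degree_lt hp0).2 hp
    have hrd : (r ^ 2 * f).natDegree < Fintype.card K := by
      by_cases hr0 : r = 0
      · simp [hr0, Fintype.card_pos]
      · have := hlt r hr hr0
        have h3 : (r ^ 2 * f).natDegree ≤ 2 * r.natDegree + f.natDegree :=
          natDegree_mul_le.trans (by gcongr; exact natDegree_pow_le)
        omega
    have hsd : (C (f.eval 0) * s ^ 2).natDegree < Fintype.card K := by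
      by_cases hs0 : s = 0
      · simp [hs0, Fintype.card_pos]
      · have := hlt s hs hs0
        have h3 : (C (f.eval 0) * s ^ 2).natDegree ≤ 2 * s.natDegree :=
          (natDegree_C_mul_le _ _).trans natDegree_pow_le
        omega
    have := natDegree_sub_le (r ^ 2 * f) (C (f.eval 0) * s ^ 2)
    rcases max_cases (r ^ 2 * f).natDegree (C (f.eval 0) * s ^ 2).natDegree <;> omega
  have hr0 := eq_C_mul_sq_of_sq_mul_eq hf key
  refine ⟨hr0, ?_⟩
  rw [hr0] at key
  have : C (f.eval 0) ≠ 0 := C_ne_zero.2 hf0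
  simpa [this] using key.symm

lemma forall_eq_zero_of_sum_X_pow_card {f : K[X]} {e d J : ℕ} (hq : Fintype.card K = 2 * e + 1)
    (hf : ¬ ∃ c g, f = C c * g ^ 2) (hf0 : f.eval 0 ≠ 0) (hd : 2 * d + f.natDegree ≤ 2 * e + 2)
    {r s : Fin J → K[X]} (hr : ∀ j, r j ∈ degreeLT K d) (hs : ∀ j, s j ∈ degreeLT K d)
    (h : ∑ j : Fin J, X ^ (Fintype.card K * j) * (r j + s j * f ^ e) = 0) (j : Fin J) :
    r j = 0 ∧ s j = 0 := by
  obtain ⟨j, hj⟩ := j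
  induction j using Nat.strong_induction_on with
  | _ j ih =>
  refine eq_zero_of_X_pow_card_dvd hq hf hf0 hd (hr _) (hs _) ?_
  rw [← Finset.add_sum_erase _ _ (Finset.mem_univ (⟨j, hj⟩ : Fin J))] at h
  have h1 : X ^ (Fintype.card K * (j + 1)) ∣ ∑ i ∈ Finset.univ.erase (⟨j, hj⟩ : Fin J),
      X ^ (Fintype.card K * i) * (r i + s i * f ^ e) := by
    refine Finset.dvd_sum fun i hi => ?_
    have hij : (i : ℕ) ≠ j := fun h => (Finset.mem_erase.1 hi).1 (Fin.ext h)
    rcases lt_or_gt_of_ne hij with hlt | hgt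
    · obtain ⟨h1, h2⟩ := ih i hlt i.2
      simp [h1, h2]
    · exact (pow_dvd_pow X (Nat.mul_le_mul_left _ hgt)).mul_right _
  have h2 : X ^ (Fintype.card K * (j + 1)) ∣
      X ^ (Fintype.card K * j) * (r ⟨j, hj⟩ + s ⟨j, hj⟩ * f ^ e) := by
    rw [eq_neg_of_add_eq_zero_left h]
    exact (dvd_neg).2 h1
  rw [Nat.mul_succ, pow_add] at h2
  exact (mul_dvd_mul_iff_left (pow_ne_zero _ X_ne_zero)).1 h2

lemma mul_card_filter_eval_pow_le [DecidableEq K] {f : K[X]} {e d c : ℕ} (a : K)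
    (hq : Fintype.card K = 2 * e + 1)
    (hf : ¬ ∃ c g, f = C c * g ^ 2) (hf0 : f.eval 0 ≠ 0) (hd : 2 * d + f.natDegree ≤ 2 * e + 2)
    (hc : c * (c + 1 + 2 * c * f.natDegree) < d) (hce : c ≤ e) :
    2 * c * (Finset.univ.filter fun x : K => (f ^ e).eval x = a).card ≤
      (2 * c + e) * f.natDegree + d + c * (2 * e + 1) := by
  have hfne : f ≠ 0 := fun h => hf0 (by simp [h])
  obtain ⟨r, s, hr, hs, ⟨j₀, hj₀⟩, hvan⟩ :=
    exists_stepanov_coefficients hfne e a (l := 2 * c) (J := c + 1) (d := d) (by nlinarith)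
  set R : K[X] := ∑ j : Fin (c + 1),
    X ^ (Fintype.card K * j) * (f ^ (2 * c) * r j + f ^ (2 * c + e) * s j) with hR
  have hRf : R = f ^ (2 * c) * ∑ j : Fin (c + 1),
      X ^ (Fintype.card K * j) * (r j + s j * f ^ e) := by
    rw [hR, Finset.mul_sum]
    exact Finset.sum_congr rfl fun j _ => by ring
  have hR0 : R ≠ 0 := by
    intro h
    rw [hRf, mul_eq_zero, or_iff_right (pow_ne_zero _ hfne)] at h
    obtain ⟨h1, h2⟩ := forall_eq_zero_of_sum_X_pow_card hq hf hf0 hd hr hs h j₀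
    exact hj₀.elim (fun h => h h1) (fun h => h h2)
  have hdvd : ∀ x : K, (f ^ e).eval x = a → (X - C x) ^ (2 * c) ∣ R := by
    intro x hx
    have h1 := X_sub_C_pow_dvd_iff_hasseDeriv (hvan x hx)
    have h2 : (X - C x) ^ (2 * c) ∣ R - ∑ j : Fin (c + 1), C (x ^ (j : ℕ)) *
        (f ^ (2 * c) * r j + f ^ (2 * c + e) * s j) := by
      rw [hR, ← Finset.sum_sub_distrib]
      refine Finset.dvd_sum fun j _ => ?_
      rw [← sub_mul]
      refine Dvd.dvd.mul_right ?_ _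
      have h3 : (X - C x) ^ Fintype.card K = X ^ Fintype.card K - C x := by
        rw [← FiniteField.expand_card (X - C x), map_sub, expand_X, expand_C]
      rw [pow_mul X, C_pow]
      have h4 : (X - C x) ^ (2 * c) ∣ (X - C x) ^ Fintype.card K := pow_dvd_pow _ (by omega)
      rw [h3] at h4
      exact h4.trans (sub_dvd_pow_sub_pow (X ^ Fintype.card K) (C x) j)
    exact (dvd_iff_dvd_of_dvd_sub h2).2 h1
  have hprod : ∏ x ∈ Finset.univ.filter (fun x : K => (f ^ e).eval x = a),
      (X - C x) ^ (2 * c) ∣ R := by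
    refine Finset.prod_dvd_of_coprime ?_ fun x hx => hdvd x (Finset.mem_filter.1 hx).2
    intro x _ y _ hxy
    exact (isCoprime_X_sub_C_of_isUnit_sub (sub_ne_zero.2 hxy).isUnit).pow
  have h1 := natDegree_le_of_dvd hprod hR0
  rw [natDegree_prod_of_monic _ _ fun x _ => (monic_X_sub_C x).pow _] at h1
  simp only [natDegree_pow, natDegree_X_sub_C, mul_one, Finset.sum_const, smul_eq_mul] at h1
  have h2 : R.natDegree ≤ (2 * c + e) * f.natDegree + d + c * (2 * e + 1) := by
    refine natDegree_sum_le_of_forall_le _ _ fun j _ => ?_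
    have hlt : ∀ p ∈ degreeLT K d, p.natDegree ≤ d := fun p hp => by
      rw [mem_degreeLT] at hp
      exact natDegree_le_of_degree_le hp.le
    have e1 : (f ^ (2 * c) * r j).natDegree ≤ (2 * c + e) * f.natDegree + d := by
      refine natDegree_mul_le.trans (add_le_add (natDegree_pow_le.trans ?_) (hlt _ (hr j)))
      gcongr
      omega
    have e2 : (f ^ (2 * c + e) * s j).natDegree ≤ (2 * c + e) * f.natDegree + d :=
      natDegree_mul_le.trans (add_le_add natDegree_pow_le (hlt _ (hs j)))
    have e3 : Fintype.card K * (j : ℕ) ≤ c * (2 * e + 1) := by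
      rw [hq, mul_comm]
      gcongr
      exact Nat.lt_succ_iff.1 j.2
    refine natDegree_mul_le.trans ?_
    rw [natDegree_X_pow]
    have := natDegree_add_le_of_degree_le e1 e2
    omega
  rw [mul_comm]
  omega

end Stepanov

section CharacterSum

variable {K : Type*} [Field K] [Fintype K] [DecidableEq K]

lemma quadraticChar_eq_ite {e : ℕ} (hq : Fintype.card K = 2 * e + 1) (y : K) :
    (quadraticChar K y : ℝ) = (if y ^ e = 1 then 1 else 0) - (if y ^ e = -1 then 1 else 0) := by
  have hchar : ringChar K ≠ 2 := fun h => by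
    have := FiniteField.even_card_of_char_two h
    omega
  have he : Fintype.card K / 2 = e := by omega
  have hpow := quadraticChar_eq_pow_of_char_ne_two' hchar y
  rw [he] at hpow
  have h1 : (1 : K) ≠ -1 := (Ring.neg_one_ne_one_of_char_ne_two hchar).symm
  by_cases hy : y = 0
  · subst hy
    have : (0 : K) ^ e = 0 := by rw [← hpow]; simp
    simp [this]
  · rcases quadraticChar_dichotomy hy with h | h <;> rw [← hpow, h] <;> simp [h1, h1.symm]

lemma sum_quadraticChar_le {f : K[X]} {e d c : ℕ}
    (hq : Fintype.card K = 2 * e + 1)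
    (hf : ¬ ∃ c g, f = C c * g ^ 2) (hf0 : f.eval 0 ≠ 0) (hd : 2 * d + f.natDegree ≤ 2 * e + 2)
    (hc : c * (c + 1 + 2 * c * f.natDegree) < d) (hce : c ≤ e) :
    c * |∑ x, (quadraticChar K (f.eval x) : ℝ)| ≤ (3 * c + e) * f.natDegree + d := by
  have hfne : f ≠ 0 := fun h => hf0 (by simp [h])
  have hchar : ringChar K ≠ 2 := fun h => by
    have := FiniteField.even_card_of_char_two h
    omega
  have he : Fintype.card K / 2 = e := by omega
  have hP := mul_card_filter_eval_pow_le 1 hq hf hf0 hd hc hce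
  have hN := mul_card_filter_eval_pow_le (-1) hq hf hf0 hd hc hce
  set P := Finset.univ.filter fun x : K => (f ^ e).eval x = 1 with hPdef
  set N := Finset.univ.filter fun x : K => (f ^ e).eval x = -1 with hNdef
  have hsum : ∑ x, (quadraticChar K (f.eval x) : ℝ) = P.card - N.card := by
    simp_rw [quadraticChar_eq_ite hq, Finset.sum_sub_distrib, ← eval_pow, Finset.sum_boole]
    rfl
  have hcover : Fintype.card K ≤ P.card + N.card + f.natDegree := by
    have hsub : (Finset.univ : Finset K) ⊆ P ∪ N ∪ f.roots.toFinset := by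
      intro x _
      simp only [hPdef, hNdef, Finset.mem_union, Finset.mem_filter, Finset.mem_univ, true_and,
        Multiset.mem_toFinset, mem_roots hfne, IsRoot.def]
      by_cases hx : f.eval x = 0
      · exact Or.inr hx
      · left
        rw [eval_pow, ← he]
        exact FiniteField.pow_dichotomy hchar hx
    calc Fintype.card K = (Finset.univ : Finset K).card := rfl
      _ ≤ (P ∪ N ∪ f.roots.toFinset).card := Finset.card_le_card hsub
      _ ≤ (P ∪ N).card + f.roots.toFinset.card := Finset.card_union_le _ _
      _ ≤ P.card + N.card + f.natDegree :=
        add_le_add (Finset.card_union_le _ _)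
          ((Multiset.toFinset_card_le _).trans (card_roots' f))
  rw [hsum]
  have hP' : (2 * c * P.card : ℝ) ≤ (2 * c + e) * f.natDegree + d + c * (2 * e + 1) := by
    exact_mod_cast hP
  have hN' : (2 * c * N.card : ℝ) ≤ (2 * c + e) * f.natDegree + d + c * (2 * e + 1) := by
    exact_mod_cast hN
  have hcov : (2 * e + 1 : ℝ) ≤ P.card + N.card + f.natDegree := by
    rw [hq] at hcover
    exact_mod_cast hcover
  have hcov' := mul_le_mul_of_nonneg_left hcov (Nat.cast_nonneg (α := ℝ) c)
  rw [← abs_of_nonneg (Nat.cast_nonneg (α := ℝ) c), ← abs_mul,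
    abs_of_nonneg (Nat.cast_nonneg (α := ℝ) c), abs_le]
  constructor <;> nlinarith

lemma sum_quadraticChar_comp_X_add_C (f : K[X]) (a : K) :
    ∑ x, (quadraticChar K ((f.comp (X + C a)).eval x) : ℝ) =
      ∑ x, (quadraticChar K (f.eval x) : ℝ) := by
  simp only [eval_comp, eval_add, eval_X, eval_C]
  exact Equiv.sum_comp (Equiv.addRight a) fun x => (quadraticChar K (f.eval x) : ℝ)

end CharacterSum

lemma exists_forall_abs_sum_quadraticChar_le (m : ℕ) {ε : ℝ} (hε : 0 < ε) :
    ∃ Q₀ : ℕ, ∀ (K : Type) [Field K] [Fintype K] [DecidableEq K], Odd (Fintype.card K) →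
      Q₀ ≤ Fintype.card K → ∀ f : K[X], f.natDegree ≤ m →
      (¬ ∃ (c : K) (g : K[X]), f = C c * g ^ 2) →
        |∑ x, (quadraticChar K (f.eval x) : ℝ)| ≤ ε * Fintype.card K := by
  obtain ⟨c, hc⟩ := exists_nat_gt (m / ε)
  set d := c * (c + 1 + 2 * c * m) + 1 with hd
  obtain ⟨Q, hQ⟩ := exists_nat_gt ((6 * m + 2 * d) / ε)
  refine ⟨Q + 2 * d + 2 * m + 2 * c + 2, fun K _ _ _ hodd hcard f hfm hf => ?_⟩
  obtain ⟨e, he⟩ := hodd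
  have hf0 : f ≠ 0 := fun h => hf ⟨0, 0, by simp [h]⟩
  obtain ⟨a, ha⟩ : ∃ a, f.eval a ≠ 0 := by
    by_contra! h
    refine hf0 (eq_zero_of_natDegree_lt_card_of_eval_eq_zero f Function.injective_id h ?_)
    omega
  have hdeg : (f.comp (X + C a)).natDegree = f.natDegree := by
    rw [natDegree_comp, natDegree_X_add_C, mul_one]
  have hsq : ¬ ∃ c g, f.comp (X + C a) = C c * g ^ 2 := by
    rintro ⟨b, g, h⟩
    refine hf ⟨b, g.comp (X - C a), ?_⟩
    have := congrArg (fun p => p.comp (X - C a)) h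
    simpa [comp_assoc] using this
  have hcpos : (0 : ℝ) < c := lt_of_le_of_lt (by positivity) hc
  have hc0 : 0 < c := by exact_mod_cast hcpos
  have hmono : c * (c + 1 + 2 * c * f.natDegree) ≤ c * (c + 1 + 2 * c * m) := by gcongr
  have hmain := sum_quadraticChar_le (f := f.comp (X + C a)) (e := e) (d := d) (c := c) he hsq
    (by simpa [eval_comp] using ha) (by rw [hdeg]; omega) (by rw [hdeg]; omega) (by omega)
  rw [sum_quadraticChar_comp_X_add_C, hdeg] at hmain
  refine le_of_mul_le_mul_left (hmain.trans ?_) hcpos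
  have hm : (f.natDegree : ℝ) ≤ m := by exact_mod_cast hfm
  rw [div_lt_iff₀ hε] at hc hQ
  have hK : (Q : ℝ) ≤ Fintype.card K := by
    exact_mod_cast (by omega : Q ≤ Fintype.card K)
  have hc1 : (1 : ℝ) ≤ c := by exact_mod_cast hc0
  have he' : (Fintype.card K : ℝ) = 2 * e + 1 := by exact_mod_cast he
  have h1 : (3 * c + e) * (f.natDegree : ℝ) ≤ (3 * c + e) * m := by gcongr
  have h2 : (Q : ℝ) * ε ≤ Fintype.card K * ε := by gcongr
  have h3 : (6 * m + 2 * d : ℝ) * c ≤ Fintype.card K * ε * c := by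
    gcongr
    linarith
  have h4 : (m : ℝ) * (2 * e + 1) ≤ c * ε * (2 * e + 1) := by gcongr
  have h5 : (d : ℝ) ≤ d * c := le_mul_of_one_le_right (by positivity) hc1
  rw [he'] at h3 ⊢
  nlinarith [Nat.cast_nonneg (α := ℝ) m]

section Discriminant

variable {R S : Type*} [CommRing R] [CommRing S]

lemma resultant_eq_of_natDegree_le {f g : R[X]} (hf : f.Monic) {N : ℕ} (hN : g.natDegree ≤ N) :
    resultant f g f.natDegree N = resultant f g := by
  obtain ⟨k, rfl⟩ := Nat.exists_eq_add_of_le hN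
  rw [resultant_add_right_deg _ _ _ _ _ le_rfl, coeff_natDegree, hf.leadingCoeff]
  simp

lemma resultant_mul_of_monic {f : R[X]} (hf : f.Monic) (g h : R[X]) :
    resultant f (g * h) = resultant f g * resultant f h := by
  rw [← resultant_eq_of_natDegree_le hf natDegree_mul_le, resultant_mul_right _ _ _ _ le_rfl]

lemma resultant_mul_monic {f g : R[X]} (hf : f.Monic) (hg : g.Monic) (h : R[X]) :
    resultant (f * g) h = resultant f h * resultant g h := by
  rw [hf.natDegree_mul hg, resultant_mul_left _ _ _ _ le_rfl]

lemma resultant_add_mul_of_monic {f : R[X]} (hf : f.Monic) (g h : R[X]) :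
    resultant f (g + f * h) = resultant f g := by
  set N := g.natDegree + (h.natDegree + f.natDegree) with hN
  have h1 : (g + f * h).natDegree ≤ N := by
    refine (natDegree_add_le _ _).trans (max_le (by omega) (natDegree_mul_le.trans (by omega)))
  rw [← resultant_eq_of_natDegree_le hf h1, ← resultant_eq_of_natDegree_le hf (g := g) (N := N)
    (by omega), resultant_add_mul_right _ _ _ _ _ (by omega) le_rfl]

/-- The discriminant of a monic polynomial. -/
noncomputable def disc (f : R[X]) : R :=
  (-1) ^ (f.natDegree.choose 2) * resultant f f.derivative

lemma disc_one : disc (1 : R[X]) = 1 := by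
  simp [disc]

lemma disc_X_sub_C (a : R) : disc (X - C a) = 1 := by
  nontriviality R
  simp [disc]

lemma disc_mul {f g : R[X]} (hf : f.Monic) (hg : g.Monic) :
    disc (f * g) = disc f * disc g * resultant f g ^ 2 := by
  have h1 : resultant f (f * g).derivative = resultant f f.derivative * resultant f g := by
    rw [derivative_mul, resultant_add_mul_of_monic hf, resultant_mul_of_monic hf]
  have h2 : resultant g (f * g).derivative = resultant g f * resultant g g.derivative := by
    rw [derivative_mul, add_comm, mul_comm (derivative f), resultant_add_mul_of_monic hg,
      resultant_mul_of_monic hg]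
  have h3 := resultant_comm g f g.natDegree f.natDegree
  have h4 : (f.natDegree + g.natDegree).choose 2 =
      f.natDegree.choose 2 + g.natDegree.choose 2 + g.natDegree * f.natDegree := by
    generalize f.natDegree = a
    generalize g.natDegree = b
    induction a with
    | zero => simp
    | succ a ih =>
      rw [add_right_comm, Nat.choose_succ_succ' (a + b), Nat.choose_succ_succ' a, ih]
      simp only [Nat.choose_one_right]
      ring
  rw [disc, disc, disc, resultant_mul_monic hf hg, h1, h2, h3, hf.natDegree_mul hg, h4, pow_add,
    pow_add]
  have h5 : ((-1 : R) ^ (g.natDegree * f.natDegree)) ^ 2 = 1 := by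
    rw [← pow_mul, mul_comm, pow_mul]; simp
  linear_combination ((-1) ^ f.natDegree.choose 2 * (-1) ^ g.natDegree.choose 2 *
    resultant f f.derivative * resultant g g.derivative * resultant f g ^ 2) * h5

lemma disc_map {f : R[X]} (hf : f.Monic) (φ : R →+* S) : disc (f.map φ) = φ (disc f) := by
  nontriviality S
  have h : (f.map φ).natDegree = f.natDegree := hf.natDegree_map φ
  rw [disc, disc, map_mul, map_pow, map_neg, map_one, h, ← resultant_map_map, derivative_map]
  congr 1
  have h1 := resultant_eq_of_natDegree_le (hf.map φ) (g := f.derivative.map φ) natDegree_map_le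
  rw [h] at h1
  exact h1.symm

lemma isUnit_disc_iff {f : R[X]} (hf : f.Monic) : IsUnit (disc f) ↔ f.Separable := by
  rw [disc, IsUnit.mul_iff, isUnit_resultant_iff_isCoprime hf, and_iff_right]
  · rfl
  · exact (isUnit_one.neg).pow _

lemma disc_prod_X_sub_C {d : ℕ} (v : Fin d → R) :
    disc (∏ i, (X - C (v i))) = (Matrix.vandermonde v).det ^ 2 := by
  induction d with
  | zero => simp [disc_one]
  | succ d ih =>
    nontriviality R
    have h1 := monic_prod_of_monic Finset.univ (fun i : Fin d => X - C (v i.succ))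
      fun i _ => monic_X_sub_C _
    rw [Fin.prod_univ_succ, disc_mul (monic_X_sub_C _) h1, ih fun i => v i.succ, disc_X_sub_C,
      Matrix.det_vandermonde, Matrix.det_vandermonde, Fin.prod_univ_succ, Fin.prod_Ioi_zero]
    have h2 : resultant (X - C (v 0)) (∏ i : Fin d, (X - C (v i.succ))) =
        ∏ i : Fin d, (v 0 - v i.succ) := by
      rw [natDegree_X_sub_C, resultant_X_sub_C_left _ _ _ le_rfl, eval_prod]
      simp
    rw [h2, one_mul, mul_pow, mul_comm]
    congr 1
    · rw [← Finset.prod_pow, ← Finset.prod_pow]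
      exact Finset.prod_congr rfl fun i _ => by ring
    · congr 1
      exact Finset.prod_congr rfl fun i _ =>
        (Fin.prod_Ioi_succ (fun j => v j - v i.succ) i).symm

end Discriminant

section Mobius

variable {K : Type*} [Field K] [Fintype K]

lemma map_eq_prod_X_sub_C_pow_card {P : K[X]} (hP : Irreducible P) (hm : P.Monic) :
    P.map (AdjoinRoot.of P) =
      ∏ i : Fin P.natDegree, (X - C ((AdjoinRoot.root P) ^ Fintype.card K ^ (i : ℕ))) := by
  have := Fact.mk hP
  have hfin : Module.Finite K (AdjoinRoot P) := (AdjoinRoot.powerBasis hP.ne_zero).finite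
  have hrank : Module.finrank K (AdjoinRoot P) = P.natDegree := by
    rw [(AdjoinRoot.powerBasis hP.ne_zero).finrank, AdjoinRoot.powerBasis_dim]
  have : Finite (AdjoinRoot P) := Module.finite_of_finite K
  have hpow (i : ℕ) (x : AdjoinRoot P) :
      (FiniteField.frobeniusAlgEquivOfAlgebraic K (AdjoinRoot P) ^ i) x =
        x ^ Fintype.card K ^ i := by
    rw [AlgEquiv.coe_pow, FiniteField.coe_frobeniusAlgEquivOfAlgebraic_iterate]
  have hinj : Function.Injective fun i : Fin P.natDegree =>
      (AdjoinRoot.root P) ^ Fintype.card K ^ (i : ℕ) := by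
    intro i j hij
    have hbij := (FiniteField.bijective_frobeniusAlgEquivOfAlgebraic_pow K (AdjoinRoot P)).1
    have h1 : (⟨i, by rw [hrank]; exact i.2⟩ : Fin (Module.finrank K (AdjoinRoot P))) =
        ⟨j, by rw [hrank]; exact j.2⟩ := by
      apply hbij
      apply AlgEquiv.coe_toAlgHom_injective
      apply AdjoinRoot.algHom_ext
      simpa [hpow] using hij
    exact Fin.ext (by simpa using h1)
  have hmon : (∏ i : Fin P.natDegree,
      (X - C ((AdjoinRoot.root P) ^ Fintype.card K ^ (i : ℕ)))).Monic :=
    monic_prod_of_monic _ _ fun i _ => monic_X_sub_C _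
  refine (eq_of_monic_of_dvd_of_natDegree_le hmon (hm.map _) ?_ ?_)
  · refine Finset.prod_dvd_of_coprime ?_ fun i _ => ?_
    · intro i _ j _ hij
      exact isCoprime_X_sub_C_of_isUnit_sub (sub_ne_zero.2 (hinj.ne hij)).isUnit
    · rw [dvd_iff_isRoot, IsRoot.def, eval_map, ← hpow]
      have h2 : eval₂ (AdjoinRoot.of P) (AdjoinRoot.root P) P = 0 := AdjoinRoot.eval₂_root P
      have h3 := congrArg (FiniteField.frobeniusAlgEquivOfAlgebraic K (AdjoinRoot P) ^ (i : ℕ)) h2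
      rw [map_zero] at h3
      rw [← h3]
      change aeval _ P = (FiniteField.frobeniusAlgEquivOfAlgebraic K (AdjoinRoot P) ^ (i : ℕ))
        (aeval (AdjoinRoot.root P) P)
      exact aeval_algHom_apply (FiniteField.frobeniusAlgEquivOfAlgebraic K (AdjoinRoot P) ^
        (i : ℕ)).toAlgHom (AdjoinRoot.root P) P
  · rw [natDegree_prod_of_monic _ _ fun i _ => monic_X_sub_C _, hm.natDegree_map]
    simp only [natDegree_X_sub_C]
    simp

variable [DecidableEq K]

/-- The Möbius function of a monic polynomial over a finite field of odd cardinality,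
by Pellet's formula. -/
noncomputable def mob (P : K[X]) : ℝ := (-1) ^ P.natDegree * quadraticChar K (disc P)

lemma mob_one : mob (1 : K[X]) = 1 := by
  simp [mob, disc_one]

lemma mob_mul {P R : K[X]} (hP : P.Monic) (hR : R.Monic) (h : IsCoprime P R) :
    mob (P * R) = mob P * mob R := by
  have h1 : resultant P R ≠ 0 := resultant_ne_zero P R h
  rw [mob, mob, mob, disc_mul hP hR, hP.natDegree_mul hR, map_mul, quadraticChar_sq_one' h1,
    mul_one, map_mul, pow_add]
  push_cast
  ring

lemma mob_eq_zero_iff {P : K[X]} (hP : P.Monic) : mob P = 0 ↔ ¬ P.Separable := by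
  rw [← isUnit_disc_iff hP, isUnit_iff_ne_zero, mob]
  rw [mul_eq_zero, or_iff_right (pow_ne_zero _ (by norm_num)), Int.cast_eq_zero,
    quadraticChar_eq_zero_iff, not_not]

lemma abs_mob_le_one (P : K[X]) : |mob P| ≤ 1 := by
  rw [mob, abs_mul, abs_pow, abs_neg, abs_one, one_pow, one_mul]
  by_cases h : disc P = 0
  · simp [h]
  · rcases quadraticChar_dichotomy h with h | h <;> simp [h]

lemma mob_of_irreducible (hodd : Odd (Fintype.card K)) {P : K[X]} (hP : Irreducible P)
    (hm : P.Monic) : mob P = -1 := by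
  have := Fact.mk hP
  obtain ⟨e, he⟩ := hodd
  have hchar : ringChar K ≠ 2 := fun h => by
    have := FiniteField.even_card_of_char_two h
    omega
  have hd : P.natDegree ≠ 0 := hP.natDegree_pos.ne'
  obtain ⟨d, hd'⟩ := Nat.exists_eq_succ_of_ne_zero hd
  set v : Fin P.natDegree → AdjoinRoot P :=
    fun i => (AdjoinRoot.root P) ^ Fintype.card K ^ (i : ℕ) with hv
  set W := (Matrix.vandermonde v).det with hW
  have hdisc : AdjoinRoot.of P (disc P) = W ^ 2 := by
    rw [← disc_map hm, map_eq_prod_X_sub_C_pow_card hP hm, disc_prod_X_sub_C]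
  have hdisc0 : disc P ≠ 0 := by
    rw [← isUnit_iff_ne_zero, isUnit_disc_iff hm]
    exact PerfectField.separable_of_irreducible hP
  have hW0 : W ≠ 0 := by
    intro h
    rw [h, zero_pow two_ne_zero, map_eq_zero] at hdisc
    exact hdisc0 hdisc
  have hroot : (AdjoinRoot.root P) ^ Fintype.card K ^ P.natDegree = AdjoinRoot.root P := by
    have hfin : Module.Finite K (AdjoinRoot P) := (AdjoinRoot.powerBasis hP.ne_zero).finite
    have hrank : Module.finrank K (AdjoinRoot P) = P.natDegree := by
      rw [(AdjoinRoot.powerBasis hP.ne_zero).finrank, AdjoinRoot.powerBasis_dim]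
    have : Finite (AdjoinRoot P) := Module.finite_of_finite K
    have : Fintype (AdjoinRoot P) := Fintype.ofFinite _
    rw [← hrank, ← Module.card_eq_pow_finrank]
    exact FiniteField.pow_card _
  have hfrob : W ^ Fintype.card K = (-1) ^ (P.natDegree - 1) * W := by
    have h1 : W ^ Fintype.card K = (Matrix.vandermonde fun i => v i ^ Fintype.card K).det := by
      rw [hW, Matrix.det_vandermonde, Matrix.det_vandermonde]
      simp only [← Finset.prod_pow]
      have h2 (x : AdjoinRoot P) :
          x ^ Fintype.card K = FiniteField.frobeniusAlgHom K (AdjoinRoot P) x := rfl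
      simp only [h2, map_sub]
    rw [h1]
    have h2 : (fun i => v i ^ Fintype.card K) = v ∘ finRotate P.natDegree := by
      funext i
      simp only [hv, Function.comp]
      rw [← pow_mul, ← pow_succ]
      by_cases hi : (i : ℕ) + 1 < P.natDegree
      · congr 2
        revert i
        rw [hd']
        intro i hi
        rw [coe_finRotate_of_ne_last]
        intro h
        simp [h] at hi
      · have hi' : (i : ℕ) + 1 = P.natDegree := by omega
        rw [hi', hroot]
        have : ((finRotate P.natDegree i : Fin _) : ℕ) = 0 := by
          clear_value v
          clear hv hroot
          revert i
          rw [hd']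
          intro i _ hi
          have : i = Fin.last d := Fin.ext (by simpa using hi)
          rw [this]
          simp
        rw [this]
        simp
    have h3 : Matrix.vandermonde (v ∘ finRotate P.natDegree) =
      (Matrix.vandermonde v).submatrix (finRotate P.natDegree) id := by
      ext i j
      simp [Matrix.vandermonde]
    rw [h2, h3, Matrix.det_permute, sign_finRotate, hW]
    simp
  have hfrob' : W ^ (2 * e) = (-1) ^ (P.natDegree - 1) := by
    rw [he, pow_succ] at hfrob
    exact mul_right_cancel₀ hW0 hfrob
  have hpow := quadraticChar_eq_pow_of_char_ne_two' hchar (disc P)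
  rw [show Fintype.card K / 2 = e by omega] at hpow
  have h5 : AdjoinRoot.of P (disc P ^ e) = AdjoinRoot.of P ((-1) ^ (P.natDegree - 1)) := by
    rw [map_pow, hdisc, ← pow_mul, hfrob']
    simp
  have h6 := (AdjoinRoot.of P).injective h5
  rw [← hpow] at h6
  have h1 : (1 : K) ≠ -1 := (Ring.neg_one_ne_one_of_char_ne_two hchar).symm
  have hfinal : quadraticChar K (disc P) = (-1) ^ (P.natDegree - 1) := by
    rcases quadraticChar_dichotomy hdisc0 with h | h <;> rw [h] at h6 ⊢ <;>
    rcases Nat.even_or_odd (P.natDegree - 1) with h' | h' <;>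
    rw [h'.neg_one_pow] at h6 ⊢ <;> push_cast at h6
    · exact absurd h6 h1
    · exact absurd h6.symm h1
  rw [mob, hfinal, hd']
  simp only [Nat.succ_eq_add_one, Nat.add_sub_cancel]
  push_cast
  rw [pow_succ, mul_assoc, mul_left_comm, ← mul_pow]
  simp

end Mobius

section Line

variable {R S : Type*} [CommRing R] [CommRing S]

lemma disc_sq_add_C (σ c : R) : disc ((X - C σ) ^ 2 + C c) = -4 * c := by
  nontriviality R
  have hm : ((X - C σ) ^ 2 + C c).Monic :=
    ((monic_X_sub_C σ).pow 2).add_of_left (by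
      rw [degree_eq_natDegree ((monic_X_sub_C σ).pow 2).ne_zero, (monic_X_sub_C σ).natDegree_pow,
        natDegree_X_sub_C]
      exact degree_C_le.trans_lt (by decide))
  have hd : ((X - C σ) ^ 2 + C c).natDegree = 2 := by
    rw [natDegree_add_C, (monic_X_sub_C σ).natDegree_pow, natDegree_X_sub_C]
  have h1 : derivative ((X - C σ) ^ 2 + C c) = C 2 * (X - C σ) := by
    simp [derivative_pow]
  have h2 : resultant ((X - C σ) ^ 2 + C c) (X - C σ) = c := by
    rw [hd, natDegree_X_sub_C, resultant_X_sub_C_right _ _ _ hd.le]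
    simp
  rw [disc, h1, resultant_mul_of_monic hm, h2, hd, natDegree_C, resultant_C_zero_right]
  norm_num

variable {K : Type*} [Field K]

/-- The discriminant of `P + b N`, as a polynomial in `b`. -/
noncomputable def lineDisc (P N : K[X]) : K[X] := disc (P.map C + C X * N.map C)

lemma monic_map_add_C_mul_map {P N : K[X]} (hP : P.Monic) (hN : N.degree < P.degree)
    [Algebra K S] [Nontrivial S] (y : S) :
    (P.map (algebraMap K S) + C y * N.map (algebraMap K S)).Monic := by
  refine (hP.map _).add_of_left ?_
  rw [hP.degree_map]
  refine lt_of_le_of_lt ?_ hN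
  rw [← smul_eq_C_mul]
  exact (degree_smul_le _ _).trans degree_map_le

lemma aeval_lineDisc [Algebra K S] {P N : K[X]} (hP : P.Monic) (hN : N.degree < P.degree) (y : S) :
    aeval y (lineDisc P N) =
      disc (P.map (algebraMap K S) + C y * N.map (algebraMap K S)) := by
  nontriviality S
  have h := disc_map (monic_map_add_C_mul_map (S := K[X]) hP hN X)
    (aeval y : K[X] →ₐ[K] S).toRingHom
  change _ = aeval y (lineDisc P N) at h
  rw [← h]
  congr 1
  simp only [Polynomial.map_add, Polynomial.map_mul, map_C, map_map]
  have : (aeval y : K[X] →ₐ[K] S).toRingHom.comp (algebraMap K K[X]) = algebraMap K S := by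
    ext; simp
  rw [this]
  simp

lemma eval_lineDisc {P N : K[X]} (hP : P.Monic) (hN : N.degree < P.degree) (b : K) :
    (lineDisc P N).eval b = disc (P + C b * N) := by
  have := aeval_lineDisc (S := K) hP hN b
  simpa [coe_aeval_eq_eval] using this

lemma natDegree_lineDisc_le {P N : K[X]} (hP : P.Monic) (hN : N.degree < P.degree) :
    (lineDisc P N).natDegree ≤ 2 * P.natDegree := by
  have hm := monic_map_add_C_mul_map (S := K[X]) hP hN X
  rw [algebraMap_eq] at hm
  have hd : (P.map C + C X * N.map C).natDegree = P.natDegree := by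
    rw [natDegree_add_eq_left_of_degree_lt, hP.natDegree_map]
    rw [hP.degree_map, ← smul_eq_C_mul]
    exact lt_of_le_of_lt ((degree_smul_le _ _).trans degree_map_le) hN
  rw [lineDisc, disc]
  have h1 : ((-1 : K[X]) ^ (P.map C + C X * N.map C).natDegree.choose 2) =
    C ((-1) ^ (P.map C + C X * N.map C).natDegree.choose 2) := by simp
  rw [h1]
  refine (natDegree_C_mul_le _ _).trans ?_
  have h2 : (derivative (P.map C + C X * N.map C)).natDegree ≤ P.natDegree - 1 := by
    refine (natDegree_derivative_le _).trans ?_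
    rw [hd]
  rw [← resultant_eq_of_natDegree_le hm h2, hd, resultant]
  have h3 : sylvester (P.map C + C X * N.map C) (derivative (P.map C + C X * N.map C))
      P.natDegree (P.natDegree - 1) =
      (X : K[X]) • (sylvester N (derivative N) P.natDegree (P.natDegree - 1)).map C +
        (sylvester P (derivative P) P.natDegree (P.natDegree - 1)).map C := by
    rw [derivative_add, derivative_C_mul, derivative_map, derivative_map]
    ext1 i j
    induction j using Fin.addCases <;>
    simp only [sylvester, Matrix.of_apply, Fin.addCases_left, Fin.addCases_right, Matrix.add_apply,
      Matrix.smul_apply, Matrix.map_apply, coeff_add, coeff_C_mul, coeff_map] <;>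
    split_ifs <;> simp [add_comm]
  rw [h3]
  refine (natDegree_det_X_add_C_le _ _).trans ?_
  simp only [Fintype.card_fin]
  omega

lemma coeff_zero_lineDisc {P N : K[X]} (hP : P.Monic) (hN : N.degree < P.degree) :
    (lineDisc P N).coeff 0 = disc P := by
  rw [coeff_zero_eq_eval_zero, eval_lineDisc hP hN]
  simp

lemma aeval_eps (f : K[X]) :
    aeval (DualNumber.eps : DualNumber K) f =
      algebraMap K _ (f.coeff 0) + f.coeff 1 • DualNumber.eps := by
  rw [aeval_eq_sum_range' (n := f.natDegree + 2) (by omega), Finset.sum_range_succ',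
    Finset.sum_range_succ']
  have : ∀ k, (DualNumber.eps : DualNumber K) ^ (k + 1 + 1) = 0 := fun k => by
    rw [pow_add, pow_add, pow_one, mul_assoc, DualNumber.eps_mul_eps, mul_zero]
  simp [this, Algebra.algebraMap_eq_smul_one]
  abel

lemma coeff_one_lineDisc_ne_zero (h2 : (2 : K) ≠ 0) {R N : K[X]} (τ : K) (hR : R.Monic)
    (hsep : R.Separable) (hτ : R.eval τ ≠ 0) (hN : N.degree < ((X - C τ) ^ 2 * R).degree)
    (hNτ : N.eval τ ≠ 0) :
    (lineDisc ((X - C τ) ^ 2 * R) N).coeff 1 ≠ 0 := by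
  set ι := algebraMap K (DualNumber K) with hι
  set ε : DualNumber K := DualNumber.eps with hε
  have hmD : ((X - C τ) ^ 2).Monic := (monic_X_sub_C τ).pow 2
  have hcop : IsCoprime ((X - C τ) ^ 2) R := by
    refine IsCoprime.pow_left ((irreducible_X_sub_C τ).coprime_iff_not_dvd.2 ?_)
    rwa [dvd_iff_isRoot]
  obtain ⟨v, u, huv⟩ := hcop
  set s := (u * N) %ₘ (X - C τ) ^ 2 with hs
  have hsdeg : s.degree < 2 := by
    refine (degree_modByMonic_lt _ hmD).trans_eq ?_
    rw [degree_pow, degree_X_sub_C]; rfl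
  have hdvd : (X - C τ) ^ 2 ∣ N - s * R := by
    have h1 := modByMonic_add_div (u * N) ((X - C τ) ^ 2)
    refine ⟨v * N + (u * N) /ₘ (X - C τ) ^ 2 * R, ?_⟩
    rw [hs]
    linear_combination (-N) * huv - R * h1
  obtain ⟨r, hr⟩ := hdvd
  have hDdeg : ((X - C τ) ^ 2 : K[X]).degree = 2 := by
    rw [degree_pow, degree_X_sub_C]; rfl
  have hPdeg : ((X - C τ) ^ 2 * R).degree = 2 + R.degree := by
    rw [degree_mul, hDdeg]
  have hRdeg : R.degree ≠ ⊥ := degree_ne_bot.2 hR.ne_zero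
  have hrdeg : r.degree < R.degree := by
    have h1 : ((X - C τ) ^ 2 * r).degree < 2 + R.degree := by
      rw [← hr]
      refine (degree_sub_le _ _).trans_lt (max_lt (hPdeg ▸ hN) ?_)
      rw [degree_mul]
      exact WithBot.add_lt_add_right hRdeg hsdeg
    rw [degree_mul, hDdeg] at h1
    exact lt_of_add_lt_add_left h1
  have hNeq : N = s * R + (X - C τ) ^ 2 * r := by linear_combination hr
  have hsτ : s.eval τ ≠ 0 := by
    intro h
    apply hNτ
    rw [hNeq]
    simp [h]
  set S₁ := ((X - C τ) ^ 2).map ι + C ε * s.map ι with hS₁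
  set S₂ := R.map ι + C ε * r.map ι with hS₂
  have hmS₁ : S₁.Monic := monic_map_add_C_mul_map hmD (by rw [hDdeg]; exact hsdeg) _
  have hmS₂ : S₂.Monic := monic_map_add_C_mul_map hR hrdeg _
  have hεε : C ε * C ε = 0 := by rw [← C_mul, hε, DualNumber.eps_mul_eps, C_0]
  have hprod : ((X - C τ) ^ 2 * R).map ι + C ε * N.map ι = S₁ * S₂ := by
    rw [hNeq, hS₁, hS₂]
    simp only [Polynomial.map_add, Polynomial.map_mul]
    linear_combination (-s.map ι * r.map ι) * hεε
  have hfst₁ : S₁.map (TrivSqZeroExt.fstHom K K K).toRingHom = (X - C τ) ^ 2 := by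
    have hid : (TrivSqZeroExt.fstHom K K K).toRingHom.comp ι = RingHom.id K := by ext; simp [hι]
    simp only [hS₁, Polynomial.map_add, Polynomial.map_mul, map_map, hid, Polynomial.map_id, map_C]
    simp [hε]
  have hfst₂ : S₂.map (TrivSqZeroExt.fstHom K K K).toRingHom = R := by
    have hid : (TrivSqZeroExt.fstHom K K K).toRingHom.comp ι = RingHom.id K := by ext; simp [hι]
    simp only [hS₂, Polynomial.map_add, Polynomial.map_mul, map_map, hid, Polynomial.map_id, map_C]
    simp [hε]
  have hdisc₂ : (disc S₂).fst ≠ 0 := by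
    have := disc_map hmS₂ (TrivSqZeroExt.fstHom K K K).toRingHom
    rw [hfst₂] at this
    change _ = (disc S₂).fst at this
    rw [← this]
    exact ((isUnit_disc_iff hR).2 hsep).ne_zero
  have hres : (resultant S₁ S₂).fst ≠ 0 := by
    have := resultant_map_map S₁ S₂ S₁.natDegree S₂.natDegree (TrivSqZeroExt.fstHom K K K).toRingHom
    rw [← hmS₁.natDegree_map (TrivSqZeroExt.fstHom K K K).toRingHom,
      ← hmS₂.natDegree_map (TrivSqZeroExt.fstHom K K K).toRingHom, hfst₁, hfst₂,
      ← hfst₁, ← hfst₂, hmS₁.natDegree_map, hmS₂.natDegree_map, hfst₁, hfst₂] at this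
    change _ = (resultant S₁ S₂).fst at this
    rw [← this, ← hmS₁.natDegree_map (TrivSqZeroExt.fstHom K K K).toRingHom,
      ← hmS₂.natDegree_map (TrivSqZeroExt.fstHom K K K).toRingHom, hfst₁, hfst₂]
    exact resultant_ne_zero _ _ ⟨v, u, huv⟩
  obtain ⟨a, b, hab⟩ : ∃ a b : K, s = C a + C b * (X - C τ) := by
    refine ⟨s.coeff 0 + s.coeff 1 * τ, s.coeff 1, ?_⟩
    have h1 : s.natDegree < 2 := by
      by_cases h0 : s = 0
      · simp [h0]
      · exact (natDegree_lt_iff_degree_lt h0).2 hsdeg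
    conv_lhs => rw [eq_X_add_C_of_natDegree_le_one (Nat.lt_succ_iff.1 h1)]
    simp only [map_add, map_mul]
    ring
  have ha : a ≠ 0 := by simpa [hab] using hsτ
  have hdisc₁ : disc S₁ = -4 * (ε * ι a) := by
    rw [← disc_sq_add_C (ι τ - ε * ι (b / 2))]
    congr 1
    have hb : ι b = 2 * ι (b / 2) := by
      rw [← map_ofNat ι 2, ← map_mul, mul_div_cancel₀ _ h2]
    rw [hS₁, hab]
    simp only [Polynomial.map_add, Polynomial.map_sub, Polynomial.map_mul, Polynomial.map_pow,
      map_X, map_C, hb,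
      C_sub, C_mul]
    have hC2 : C (2 : DualNumber K) = 2 := map_ofNat C 2
    rw [hC2]
    linear_combination (-(C (ι (b/2)))^2) * hεε
  have hmain := aeval_lineDisc (S := DualNumber K) (hmD.mul hR) hN ε
  rw [← hι, hprod, disc_mul hmS₁ hmS₂, hdisc₁] at hmain
  intro h0
  have h1 := congrArg TrivSqZeroExt.snd hmain
  rw [hε, aeval_eps, h0] at h1
  have h4 : (4 : DualNumber K) = ι 4 := (map_ofNat ι 4).symm
  rw [h4] at h1
  simp [hι, TrivSqZeroExt.algebraMap_eq_inl] at h1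
  have h40 : (4 : K) ≠ 0 := by
    rw [show (4 : K) = 2 * 2 by norm_num]
    exact mul_ne_zero h2 h2
  rcases h1 with ((h1 | h1) | h1) | h1
  exacts [h40 h1, ha h1, hdisc₂ h1, hres h1]

lemma not_exists_eq_C_mul_sq {f : K[X]} (h0 : f.coeff 0 = 0) (h1 : f.coeff 1 ≠ 0) :
    ¬ ∃ (c : K) (g : K[X]), f = C c * g ^ 2 := by
  rintro ⟨c, g, rfl⟩
  apply h1
  rw [coeff_C_mul, sq, mul_coeff_one]
  rw [coeff_C_mul, sq, mul_coeff_zero, mul_eq_zero, mul_self_eq_zero] at h0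
  rcases h0 with h0 | h0 <;> simp [h0]

lemma degree_C_mul_lt {P N : K[X]} (hN : N.degree < P.degree) (b : K) :
    (C b * N).degree < P.degree := by
  rw [← smul_eq_C_mul]
  exact (degree_smul_le _ _).trans_lt hN

end Line

section LineSum

variable {K : Type*} [Field K] [Fintype K] [DecidableEq K]

/-- Square-root type cancellation with saving `ε` for quadratic character sums of polynomials of
degree at most `m`. -/
def CharacterSumBound (K : Type*) [Field K] [Fintype K] [DecidableEq K] (m : ℕ) (ε : ℝ) : Prop :=
  ∀ f : K[X], f.natDegree ≤ m → (¬ ∃ (c : K) (g : K[X]), f = C c * g ^ 2) →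
    |∑ x, (quadraticChar K (f.eval x) : ℝ)| ≤ ε * Fintype.card K

lemma mob_add_C_mul {P N : K[X]} (hP : P.Monic) (hN : N.degree < P.degree) (b : K) :
    mob (P + C b * N) = (-1) ^ P.natDegree * quadraticChar K ((lineDisc P N).eval b) := by
  rw [mob, eval_lineDisc hP hN, natDegree_add_eq_left_of_degree_lt (degree_C_mul_lt hN b)]

lemma abs_sum_mob_line_le {m : ℕ} {ε : ℝ} (hB : CharacterSumBound K (4 * m) ε)
    (h2 : (2 : K) ≠ 0) {ψ : K[X] → ℝ} (hψ : ψ = (fun _ => 1) ∨ ψ = mob)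
    {R A N : K[X]} (τ : K) (hR : R.Monic) (hsep : R.Separable) (hτ : R.eval τ ≠ 0)
    (hm : ((X - C τ) ^ 2 * R).natDegree = m)
    (hA : A.degree < ((X - C τ) ^ 2 * R).degree) (hAsep : ((X - C τ) ^ 2 * R + A).Separable)
    (hN : N.degree < ((X - C τ) ^ 2 * R).degree) (hNτ : N.eval τ ≠ 0) :
    |∑ b : K, mob ((X - C τ) ^ 2 * R + C b * N) * ψ ((X - C τ) ^ 2 * R + C b * N + A)| ≤
      ε * Fintype.card K := by
  have hP : ((X - C τ) ^ 2 * R).Monic := ((monic_X_sub_C τ).pow 2).mul hR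
  have h1 := coeff_one_lineDisc_ne_zero h2 τ hR hsep hτ hN hNτ
  have hd1 := natDegree_lineDisc_le hP hN
  have h0 : (lineDisc ((X - C τ) ^ 2 * R) N).coeff 0 = 0 := by
    rw [coeff_zero_lineDisc hP hN]
    by_contra h
    have h3 := (isUnit_disc_iff hP).1 (isUnit_iff_ne_zero.2 h)
    have h4 := h3.squarefree (X - C τ) (by rw [← sq]; exact dvd_mul_right _ _)
    exact not_isUnit_X_sub_C _ h4
  have hsign (k : ℕ) (S : ℝ) : |(-1) ^ k * S| = |S| := by
    rw [abs_mul, abs_pow, abs_neg, abs_one, one_pow, one_mul]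
  set P := (X - C τ) ^ 2 * R with hPdef
  rcases hψ with rfl | rfl
  · simp only [mul_one, mob_add_C_mul hP hN, ← Finset.mul_sum]
    rw [hsign]
    exact hB _ (by omega) (not_exists_eq_C_mul_sq h0 h1)
  · have hPA : (P + A).Monic := hP.add_of_left hA
    have hdeg : (P + A).degree = P.degree := degree_add_eq_left_of_degree_lt hA
    have hN' : N.degree < (P + A).degree := by rwa [hdeg]
    have hd2 := natDegree_lineDisc_le hPA hN'
    rw [natDegree_eq_of_degree_eq hdeg] at hd2
    have h3 (b : K) : P + C b * N + A = P + A + C b * N := by ring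
    have h02 : (lineDisc (P + A) N).coeff 0 ≠ 0 := by
      rw [coeff_zero_lineDisc hPA hN']
      exact ((isUnit_disc_iff hPA).2 hAsep).ne_zero
    have h4 := hB (lineDisc P N * lineDisc (P + A) N) (natDegree_mul_le.trans (by omega))
      (not_exists_eq_C_mul_sq (by rw [mul_coeff_zero, h0, zero_mul]) (by
        rw [mul_coeff_one, h0, zero_mul, zero_add]
        exact mul_ne_zero h1 h02))
    convert h4 using 1
    simp only [h3, mob_add_C_mul hP hN, mob_add_C_mul hPA hN', eval_mul, map_mul, Int.cast_mul]
    rw [← hsign ((P + A).natDegree + P.natDegree), Finset.mul_sum]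
    simp only [pow_add]
    congr 1
    rw [← Finset.sum_congr rfl fun b _ => ?_]
    have h5 (k : ℕ) : ((-1 : ℝ) ^ k) ^ 2 = 1 := by rw [← pow_mul, mul_comm, pow_mul]; simp
    linear_combination (-(quadraticChar K ((lineDisc P N).eval b) : ℝ) *
      quadraticChar K ((lineDisc (P + A) N).eval b)) *
        (h5 P.natDegree * ((-1 : ℝ) ^ (P + A).natDegree) ^ 2 + h5 (P + A).natDegree)

end LineSum

section Counting

open scoped Classical

variable {K : Type*} [Field K] [Fintype K]

/-- The polynomials of degree less than `k` over a finite field. -/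
noncomputable def lowDeg (K : Type*) [Field K] [Fintype K] (k : ℕ) : Finset K[X] :=
  Finset.univ.map ⟨fun v : Fin k → K => ((degreeLTEquiv K k).symm v : K[X]),
    Subtype.val_injective.comp (degreeLTEquiv K k).symm.injective⟩

lemma mem_lowDeg {k : ℕ} {P : K[X]} : P ∈ lowDeg K k ↔ P.degree < k := by
  simp only [lowDeg, Finset.mem_map, Finset.mem_univ, true_and, Function.Embedding.coeFn_mk]
  constructor
  · rintro ⟨v, rfl⟩
    exact mem_degreeLT.1 ((degreeLTEquiv K k).symm v).2
  · intro h
    exact ⟨degreeLTEquiv K k ⟨P, mem_degreeLT.2 h⟩, by simp⟩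

lemma card_lowDeg (k : ℕ) : (lowDeg K k).card = Fintype.card K ^ k := by
  simp [lowDeg]

/-- The monic polynomials of degree `k` over a finite field. -/
noncomputable def monics (K : Type*) [Field K] [Fintype K] (k : ℕ) : Finset K[X] :=
  (lowDeg K k).map (addLeftEmbedding (X ^ k))

lemma mem_monics {k : ℕ} {P : K[X]} : P ∈ monics K k ↔ P.Monic ∧ P.natDegree = k := by
  simp only [monics, Finset.mem_map, mem_lowDeg, addLeftEmbedding_apply]
  constructor
  · rintro ⟨Q, hQ, rfl⟩
    refine ⟨monic_X_pow_add hQ, ?_⟩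
    rw [natDegree_add_eq_left_of_degree_lt (by rwa [degree_X_pow]), natDegree_X_pow]
  · rintro ⟨hP, rfl⟩
    refine ⟨P - X ^ P.natDegree, ?_, by ring⟩
    have h1 : P.degree = (X ^ P.natDegree : K[X]).degree := by
      rw [degree_X_pow, degree_eq_natDegree hP.ne_zero]
    have := degree_sub_lt_left h1 hP.ne_zero (by rw [hP.leadingCoeff, (monic_X_pow _).leadingCoeff])
    rwa [degree_eq_natDegree hP.ne_zero] at this

lemma card_monics (k : ℕ) : (monics K k).card = Fintype.card K ^ k := by
  simp [monics, card_lowDeg]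

lemma add_mem_monics {k : ℕ} {P A : K[X]} (hP : P ∈ monics K k) (hA : A.degree < k) :
    P + A ∈ monics K k := by
  rw [mem_monics] at hP ⊢
  obtain ⟨hP, rfl⟩ := hP
  rw [← degree_eq_natDegree hP.ne_zero] at hA
  exact ⟨hP.add_of_left hA, natDegree_add_eq_left_of_degree_lt hA⟩

lemma sum_monics_add {k : ℕ} {A : K[X]} (hA : A.degree < k) (f : K[X] → ℝ) :
    ∑ P ∈ monics K k, f (P + A) = ∑ P ∈ monics K k, f P := by
  refine Finset.sum_bij' (fun P _ => P + A) (fun P _ => P - A) (fun P hP => add_mem_monics hP hA)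
    (fun P hP => ?_) (fun P _ => by ring) (fun P _ => by ring) (fun P _ => rfl)
  rw [sub_eq_add_neg]
  exact add_mem_monics hP (by rwa [degree_neg])

lemma mul_mem_monics {a b : ℕ} {P R : K[X]} (hP : P ∈ monics K a) (hR : R ∈ monics K b) :
    P * R ∈ monics K (a + b) := by
  rw [mem_monics] at hP hR ⊢
  exact ⟨hP.1.mul hR.1, by rw [hP.1.natDegree_mul hR.1, hP.2, hR.2]⟩

lemma exists_monics_dvd_sub {k g : ℕ} {G : K[X]} (hG : G ∈ monics K g) (hgk : g ≤ k) (a : K[X]) :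
    ∃ P ∈ monics K k, G ∣ P - a := by
  obtain ⟨hGm, rfl⟩ := mem_monics.1 hG
  refine ⟨X ^ k + (a - X ^ k) %ₘ G, ?_, ?_⟩
  · refine add_mem_monics (mem_monics.2 ⟨monic_X_pow k, natDegree_X_pow k⟩) ?_
    refine (degree_modByMonic_lt _ hGm).trans_le ?_
    rw [degree_eq_natDegree hGm.ne_zero]
    exact_mod_cast hgk
  · refine ⟨-((a - X ^ k) /ₘ G), ?_⟩
    linear_combination modByMonic_add_div (a - X ^ k) G

lemma filter_dvd_sub_eq_map {k g : ℕ} {G P₀ a : K[X]} (hG : G ∈ monics K g) (hgk : g ≤ k)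
    (hP₀ : P₀ ∈ monics K k) (hd : G ∣ P₀ - a) :
    (monics K k).filter (fun P => G ∣ P - a) =
      (lowDeg K (k - g)).image fun L => P₀ + G * L := by
  obtain ⟨hGm, rfl⟩ := mem_monics.1 hG
  have hdegG := degree_eq_natDegree hGm.ne_zero
  ext P
  simp only [Finset.mem_filter, Finset.mem_image, mem_lowDeg]
  constructor
  · rintro ⟨hP, h⟩
    obtain ⟨L, hL⟩ : G ∣ P - P₀ := by
      have := dvd_sub h hd
      rwa [sub_sub_sub_cancel_right] at this
    refine ⟨L, ?_, by rw [← hL]; ring⟩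
    rw [mem_monics] at hP hP₀
    by_cases hL0 : L = 0
    · rw [hL0, degree_zero]; exact WithBot.bot_lt_coe _
    have h1 : (P - P₀).degree < k := by
      have h2 : P.degree = P₀.degree := by
        rw [degree_eq_natDegree hP.1.ne_zero, degree_eq_natDegree hP₀.1.ne_zero, hP.2, hP₀.2]
      have := degree_sub_lt_left h2 hP.1.ne_zero (by rw [hP.1.leadingCoeff, hP₀.1.leadingCoeff])
      rwa [degree_eq_natDegree hP.1.ne_zero, hP.2] at this
    rw [hL, degree_mul, hdegG, degree_eq_natDegree hL0] at h1
    rw [degree_eq_natDegree hL0]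
    norm_cast at h1 ⊢
    omega
  · rintro ⟨L, hL, rfl⟩
    refine ⟨add_mem_monics hP₀ ?_, ?_⟩
    · by_cases hL0 : L = 0
      · rw [hL0, mul_zero, degree_zero]; exact WithBot.bot_lt_coe _
      rw [degree_mul, hdegG, degree_eq_natDegree hL0]
      rw [degree_eq_natDegree hL0] at hL
      norm_cast at hL ⊢
      omega
    · rw [add_sub_right_comm]
      exact dvd_add hd (dvd_mul_right _ _)

lemma sum_filter_dvd_sub {k g : ℕ} {G P₀ a : K[X]} (hG : G ∈ monics K g) (hgk : g ≤ k)
    (hP₀ : P₀ ∈ monics K k) (hd : G ∣ P₀ - a) (f : K[X] → ℝ) :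
    ∑ P ∈ (monics K k).filter (fun P => G ∣ P - a), f P =
      ∑ L ∈ lowDeg K (k - g), f (P₀ + G * L) := by
  rw [filter_dvd_sub_eq_map hG hgk hP₀ hd, Finset.sum_image]
  intro L _ L' _ h
  exact mul_left_cancel₀ (mem_monics.1 hG).1.ne_zero (add_left_cancel h)

lemma card_filter_dvd_sub {k g : ℕ} {G : K[X]} (hG : G ∈ monics K g) (hgk : g ≤ k) (a : K[X]) :
    ((monics K k).filter (fun P => G ∣ P - a)).card = Fintype.card K ^ (k - g) := by
  obtain ⟨P₀, hP₀, hd⟩ := exists_monics_dvd_sub hG hgk a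
  have := sum_filter_dvd_sub hG hgk hP₀ hd fun _ => 1
  simp only [Finset.sum_const, nsmul_eq_mul, mul_one, card_lowDeg] at this
  exact_mod_cast this

lemma card_filter_dvd {k g : ℕ} {G : K[X]} (hG : G ∈ monics K g) (hgk : g ≤ k) :
    ((monics K k).filter (fun P => G ∣ P)).card = Fintype.card K ^ (k - g) := by
  simpa using card_filter_dvd_sub hG hgk 0

lemma exists_crt {K : Type*} [Field K] {D₁ D₂ : K[X]} (h : IsCoprime D₁ D₂) (A : K[X]) :
    ∃ a, ∀ P, (D₁ ∣ P ∧ D₂ ∣ P + A) ↔ D₁ * D₂ ∣ P - a := by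
  obtain ⟨u, v, huv⟩ := h
  have h : IsCoprime D₁ D₂ := ⟨u, v, huv⟩
  refine ⟨-(u * D₁ * A), fun P => ?_⟩
  have h1 : D₁ ∣ P ↔ D₁ ∣ P - -(u * D₁ * A) := by
    rw [sub_neg_eq_add]
    exact (dvd_add_left ⟨u * A, by ring⟩).symm
  have h2 : D₂ ∣ P + A ↔ D₂ ∣ P - -(u * D₁ * A) := by
    have : P + A = (P - -(u * D₁ * A)) + D₂ * (v * A) := by linear_combination (-A) * huv
    rw [this]
    exact dvd_add_left (dvd_mul_right _ _)
  rw [h1, h2]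
  exact ⟨fun h' => h.mul_dvd h'.1 h'.2,
    fun h' => ⟨(dvd_mul_right _ _).trans h', (dvd_mul_left _ _).trans h'⟩⟩

lemma card_filter_dvd_dvd {k d₁ d₂ : ℕ} {D₁ D₂ A : K[X]} (h : IsCoprime D₁ D₂)
    (h₁ : D₁ ∈ monics K d₁) (h₂ : D₂ ∈ monics K d₂) (hk : d₁ + d₂ ≤ k) :
    ((monics K k).filter (fun P => D₁ ∣ P ∧ D₂ ∣ P + A)).card =
      Fintype.card K ^ (k - (d₁ + d₂)) := by
  obtain ⟨a, ha⟩ := exists_crt h A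
  simp_rw [ha]
  exact card_filter_dvd_sub (mul_mem_monics h₁ h₂) hk a

end Counting

section Divisors

open scoped Classical

variable {K : Type*} [Field K] [Fintype K]

/-- The monic divisors of a nonzero polynomial. -/
noncomputable def divs (P : K[X]) : Finset K[X] :=
  ((Finset.range (P.natDegree + 1)).biUnion (monics K)).filter (· ∣ P)

lemma mem_divs {P D : K[X]} (hP : P ≠ 0) : D ∈ divs P ↔ D.Monic ∧ D ∣ P := by
  simp only [divs, Finset.mem_filter, Finset.mem_biUnion, Finset.mem_range, mem_monics]
  constructor
  · rintro ⟨⟨k, _, h, _⟩, hd⟩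
    exact ⟨h, hd⟩
  · rintro ⟨h, hd⟩
    exact ⟨⟨_, Nat.lt_succ_of_le (natDegree_le_of_dvd hd hP), h, rfl⟩, hd⟩

lemma exists_monic_irreducible_dvd {K : Type*} [Field K] {P : K[X]} (hP : ¬ IsUnit P) (h0 : P ≠ 0) :
    ∃ π : K[X], π.Monic ∧ Irreducible π ∧ π ∣ P := by
  obtain ⟨g, hg, hd⟩ := WfDvdMonoid.exists_irreducible_factor hP h0
  exact ⟨normalize g, monic_normalize hg.ne_zero, (normalize_associated g).symm.irreducible hg,
    (normalize_associated g).dvd.trans hd⟩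

lemma exists_eq_mul_of_irreducible_dvd {K : Type*} [Field K] {P π : K[X]} (hm : π.Monic)
    (hd : π ∣ P) (hP : P.Monic) :
    ∃ Q : K[X], Q.Monic ∧ P = π * Q := by
  obtain ⟨Q, rfl⟩ := hd
  exact ⟨Q, hm.of_mul_monic_left hP, rfl⟩

lemma card_divs_le {P : K[X]} (hP : P ≠ 0) : (divs P).card ≤ 2 ^ P.natDegree := by
  induction hn : P.natDegree using Nat.strong_induction_on generalizing P with
  | _ n ih =>
  by_cases hu : IsUnit P
  · have : divs P ⊆ {1} := by
      intro D hD
      rw [mem_divs hP] at hD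
      rw [Finset.mem_singleton]
      exact hD.1.eq_one_of_isUnit (isUnit_of_dvd_unit hD.2 hu)
    exact (Finset.card_le_card this).trans (by simpa using Nat.one_le_two_pow)
  obtain ⟨π, hm, hi, Q, rfl⟩ := exists_monic_irreducible_dvd hu hP
  have hQ : Q ≠ 0 := right_ne_zero_of_mul hP
  rw [natDegree_mul hm.ne_zero hQ] at hn
  have hpos := hi.natDegree_pos
  have h1 := ih Q.natDegree (by omega) hQ rfl
  have h2 : divs (π * Q) ⊆ divs Q ∪ (divs Q).image (π * ·) := by
    intro D hD
    rw [mem_divs hP] at hD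
    rw [Finset.mem_union, Finset.mem_image]
    by_cases h : π ∣ D
    · obtain ⟨E, hE, rfl⟩ := exists_eq_mul_of_irreducible_dvd hm h hD.1
      exact Or.inr ⟨E, (mem_divs hQ).2 ⟨hE, (mul_dvd_mul_iff_left hm.ne_zero).1 hD.2⟩, rfl⟩
    · exact Or.inl ((mem_divs hQ).2
        ⟨hD.1, ((hi.coprime_iff_not_dvd.2 h).symm).dvd_of_dvd_mul_left hD.2⟩)
  calc _ ≤ _ := Finset.card_le_card h2
    _ ≤ (divs Q).card + (divs Q).card :=
      (Finset.card_union_le _ _).trans (Nat.add_le_add_left Finset.card_image_le _)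
    _ ≤ 2 ^ (Q.natDegree + 1) := by rw [pow_succ]; omega
    _ ≤ 2 ^ n := Nat.pow_le_pow_right (by norm_num) (by omega)

lemma card_filter_dvd_le {k g : ℕ} {G : K[X]} (hG : G ∈ monics K g) :
    ((monics K k).filter (fun P => G ∣ P)).card * Fintype.card K ^ g ≤ Fintype.card K ^ k := by
  by_cases h : g ≤ k
  · rw [card_filter_dvd hG h, ← pow_add, Nat.sub_add_cancel h]
  · rw [Finset.filter_false_of_mem, Finset.card_empty, zero_mul]
    · exact Nat.zero_le _
    intro P hP hd
    rw [mem_monics] at hP hG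
    have := natDegree_le_of_dvd hd hP.1.ne_zero
    omega

lemma card_filter_not_squarefree_le (k : ℕ) :
    Fintype.card K * ((monics K k).filter (fun P => ¬ Squarefree P)).card ≤
      k * Fintype.card K ^ k := by
  set q := Fintype.card K with hq
  have hqpos : 0 < q := Fintype.card_pos
  have h1 : (monics K k).filter (fun P => ¬ Squarefree P) ⊆
      (Finset.Icc 1 k).biUnion fun d => (monics K d).biUnion fun D =>
        (monics K k).filter (fun P => D * D ∣ P) := by
    intro P hP
    simp only [Finset.mem_filter, Squarefree, not_forall] at hP
    obtain ⟨hPk, x, hx, hu⟩ := hP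
    have hPm := mem_monics.1 hPk
    have hx0 : x ≠ 0 := by
      rintro rfl
      rw [zero_mul, zero_dvd_iff] at hx
      exact hPm.1.ne_zero hx
    obtain ⟨π, hm, hi, hd⟩ := exists_monic_irreducible_dvd hu hx0
    simp only [Finset.mem_biUnion, Finset.mem_filter, Finset.mem_Icc]
    have hdd : π * π ∣ P := (mul_dvd_mul hd hd).trans hx
    have hle := natDegree_le_of_dvd ((dvd_mul_right _ _).trans hdd) hPm.1.ne_zero
    exact ⟨π.natDegree, ⟨hi.natDegree_pos, by omega⟩, π, mem_monics.2 ⟨hm, rfl⟩, hPk, hdd⟩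
  calc _ ≤ q * ∑ d ∈ Finset.Icc 1 k, ∑ D ∈ monics K d,
        ((monics K k).filter (fun P => D * D ∣ P)).card := by
        gcongr
        refine (Finset.card_le_card h1).trans (Finset.card_biUnion_le.trans ?_)
        exact Finset.sum_le_sum fun d _ => Finset.card_biUnion_le
    _ = ∑ d ∈ Finset.Icc 1 k, ∑ D ∈ monics K d,
        q * ((monics K k).filter (fun P => D * D ∣ P)).card := by
        simp only [Finset.mul_sum]
    _ ≤ ∑ d ∈ Finset.Icc 1 k, q ^ k := by
        refine Finset.sum_le_sum fun d hd => ?_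
        have hd1 := (Finset.mem_Icc.1 hd).1
        refine Nat.le_of_mul_le_mul_right ?_ (pow_pos hqpos d)
        rw [Finset.sum_mul, mul_comm (q ^ k), ← smul_eq_mul (q ^ d), ← card_monics (K := K) d,
          ← Finset.sum_const]
        refine Finset.sum_le_sum fun D hD => ?_
        refine le_trans ?_ (card_filter_dvd_le (mul_mem_monics hD hD))
        rw [card_monics, mul_comm q, mul_assoc, ← hq, ← pow_succ']
        gcongr
    _ = _ := by simp

lemma card_filter_not_isCoprime_le (k : ℕ) {A : K[X]} (hA : A ≠ 0) :
    Fintype.card K * ((monics K k).filter (fun P => ¬ IsCoprime P A)).card ≤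
      2 ^ A.natDegree * Fintype.card K ^ k := by
  set q := Fintype.card K with hq
  have hqpos : 0 < q := Fintype.card_pos
  have h1 : (monics K k).filter (fun P => ¬ IsCoprime P A) ⊆
      ((divs A).filter (fun D => ¬ IsUnit D)).biUnion fun D =>
        (monics K k).filter (fun P => D ∣ P) := by
    intro P hP
    rw [Finset.mem_filter] at hP
    obtain ⟨hPk, hc⟩ := hP
    have hPm := mem_monics.1 hPk
    have hu : ¬ IsUnit (EuclideanDomain.gcd P A) := by rwa [EuclideanDomain.gcd_isUnit_iff]
    obtain ⟨π, hm, hi, hd⟩ := exists_monic_irreducible_dvd hu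
      (fun h => hA (EuclideanDomain.gcd_eq_zero_iff.1 h).2)
    simp only [Finset.mem_biUnion, Finset.mem_filter]
    exact ⟨π, ⟨(mem_divs hA).2 ⟨hm, hd.trans (EuclideanDomain.gcd_dvd_right _ _)⟩, hi.not_isUnit⟩,
      hPk, hd.trans (EuclideanDomain.gcd_dvd_left _ _)⟩
  calc _ ≤ q * ∑ D ∈ (divs A).filter (fun D => ¬ IsUnit D),
        ((monics K k).filter (fun P => D ∣ P)).card := by
        gcongr
        exact (Finset.card_le_card h1).trans Finset.card_biUnion_le
    _ = ∑ D ∈ (divs A).filter (fun D => ¬ IsUnit D),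
        q * ((monics K k).filter (fun P => D ∣ P)).card := Finset.mul_sum _ _ _
    _ ≤ ∑ D ∈ (divs A).filter (fun D => ¬ IsUnit D), q ^ k := by
        refine Finset.sum_le_sum fun D hD => ?_
        rw [Finset.mem_filter, mem_divs hA] at hD
        have hpos : D.natDegree ≠ 0 := fun h =>
          hD.2 (by rw [hD.1.1.natDegree_eq_zero.1 h]; exact isUnit_one)
        refine le_trans ?_ (card_filter_dvd_le (mem_monics.2 ⟨hD.1.1, rfl⟩))
        rw [mul_comm]
        gcongr
        exact Nat.le_self_pow hpos _
    _ = ((divs A).filter (fun D => ¬ IsUnit D)).card * q ^ k := by simp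
    _ ≤ _ := by
        gcongr
        exact (Finset.card_filter_le _ _).trans (card_divs_le hA)

end Divisors

section GoodLines

open scoped Classical

variable {K : Type*} [Field K] [Fintype K]

lemma card_not_squarefree_add_mul_sq_le (h2 : (2 : K) ≠ 0) {S : K[X]} {τ : K}
    (hS : S.eval τ ≠ 0) :
    (Finset.univ.filter fun b : K => ¬ Squarefree (S + C b * (X - C τ) ^ 2)).card ≤
      2 ^ (S.natDegree + 2) := by
  set T : K[X] := (X - C τ) ^ 2 with hT
  have hTτ : T.eval τ = 0 := by simp [hT]
  set W : K[X] := T * derivative S - derivative T * S with hW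
  have hW' : W = (X - C τ) * ((X - C τ) * derivative S - 2 * S) := by
    rw [hW, hT, derivative_X_sub_C_sq]
    simp only [map_ofNat]
    ring
  have hW0 : W ≠ 0 := by
    rw [hW']
    refine mul_ne_zero (X_sub_C_ne_zero τ) fun h => ?_
    have := congrArg (eval τ) h
    simp [h2, hS] at this
  have hdeg : W.natDegree ≤ S.natDegree + 2 := by
    have hTd : T.natDegree = 2 := by rw [hT, natDegree_pow, natDegree_X_sub_C]
    refine (natDegree_sub_le _ _).trans (max_le ?_ ?_)
    · have := natDegree_derivative_le S
      exact natDegree_mul_le.trans (by omega)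
    · have := natDegree_derivative_le T
      exact natDegree_mul_le.trans (by omega)
  have key (b : K) (hb : ¬ Squarefree (S + C b * T)) :
      ∃ D : K[X], D ∈ divs W ∧ ¬ IsUnit D ∧ D ∣ S + C b * T := by
    simp only [Squarefree, not_forall] at hb
    obtain ⟨x, hx, hu⟩ := hb
    have hx0 : x ≠ 0 := by
      rintro rfl
      rw [zero_mul, zero_dvd_iff] at hx
      have := congrArg (eval τ) hx
      simp [hTτ, hS] at this
    obtain ⟨D, hm, hi, hd⟩ := exists_monic_irreducible_dvd hu hx0
    obtain ⟨E, hE⟩ := (mul_dvd_mul hd hd).trans hx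
    refine ⟨D, (mem_divs hW0).2 ⟨hm, ?_⟩, hi.not_isUnit, ⟨D * E, by rw [hE, mul_assoc]⟩⟩
    have h3 : W = T * derivative (S + C b * T) - derivative T * (S + C b * T) := by
      rw [hW]
      simp only [derivative_add, derivative_mul, derivative_C]
      ring
    rw [h3, hE]
    simp only [derivative_mul]
    exact ⟨T * (derivative D * E + derivative D * E + D * derivative E) - derivative T * (D * E),
      by ring⟩
  choose! f hf using key
  refine (Finset.card_le_card_of_injOn f (t := divs W) ?_ ?_).trans
    ((card_divs_le hW0).trans (Nat.pow_le_pow_right (by norm_num) hdeg))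
  · intro b hb
    exact (hf b (Finset.mem_filter.1 hb).2).1
  · intro b hb b' hb' hbb
    by_contra hne
    obtain ⟨-, hu, hd⟩ := hf b (Finset.mem_filter.1 hb).2
    obtain ⟨-, -, hd'⟩ := hf b' (Finset.mem_filter.1 hb').2
    rw [← hbb] at hd'
    have h4 : f b ∣ C (b - b') * T := by
      have := dvd_sub hd hd'
      rw [C_sub]
      convert this using 1
      ring
    have h5 : f b ∣ T :=
      (IsUnit.dvd_mul_left (isUnit_C.2 (isUnit_iff_ne_zero.2 (sub_ne_zero.2 hne)))).1 h4
    have hcop : IsCoprime (S + C b * T) (X - C τ) := by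
      refine ((irreducible_X_sub_C τ).coprime_iff_not_dvd.2 ?_).symm
      rw [dvd_iff_isRoot, IsRoot.def]
      simp [hTτ, hS]
    exact hu ((hcop.pow_right (n := 2)).isUnit_of_dvd' hd h5)

/-- The discriminant-of-a-pencil condition at `τ`: the polynomial `(X - τ)²R` has exactly one
repeated root, and its shift by `A` has none. -/
def IsGood (A R : K[X]) (τ : K) : Prop :=
  R.Separable ∧ R.eval τ ≠ 0 ∧ ((X - C τ) ^ 2 * R + A).Separable

lemma mul_card_filter_le_of_forall_add {k C₀ : ℕ} (hk : 0 < k) (p : K[X] → Prop) [DecidablePred p]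
    (h : ∀ R ∈ monics K k, (Finset.univ.filter fun b : K => p (R + C b)).card ≤ C₀) :
    Fintype.card K * ((monics K k).filter p).card ≤ C₀ * Fintype.card K ^ k := by
  have h1 (b : K) :
      ((monics K k).filter p).card = ∑ R ∈ monics K k, if p (R + C b) then 1 else 0 := by
    have hb : (C b).degree < k := degree_C_le.trans_lt (by exact_mod_cast hk)
    have := sum_monics_add hb fun R => if p R then (1 : ℝ) else 0
    rw [Finset.card_filter]
    exact_mod_cast this.symm
  calc _ = ∑ b : K, ∑ R ∈ monics K k, if p (R + C b) then 1 else 0 := by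
        rw [← Finset.sum_congr rfl fun b _ => h1 b]
        simp
    _ = ∑ R ∈ monics K k, (Finset.univ.filter fun b : K => p (R + C b)).card := by
        rw [Finset.sum_comm]
        simp only [Finset.card_filter]
    _ ≤ ∑ R ∈ monics K k, C₀ := Finset.sum_le_sum h
    _ = _ := by simp [card_monics, mul_comm]

lemma separable_sq_add {A : K[X]} (h2 : (2 : K) ≠ 0) (hA : A ≠ 0) (hdeg : A.natDegree ≤ 1) :
    (Finset.univ.filter fun τ : K => ¬ ((X - C τ) ^ 2 + A).Separable).card ≤ 1 := by
  obtain ⟨a, b, rfl⟩ := exists_eq_X_add_C_of_natDegree_le_one hdeg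
  have h3 (τ : K) : (X - C τ) ^ 2 + (C a * X + C b) =
      (X - C (τ - a / 2)) ^ 2 + C (b + τ * a - a ^ 2 / 4) := by
    have h4 : (4 : K) ≠ 0 := by
      have : (4 : K) = 2 * 2 := by norm_num
      rw [this]
      exact mul_ne_zero h2 h2
    have e1 : C a = 2 * C (a / 2) := by
      rw [← map_ofNat C 2, ← C_mul]
      congr 1
      field_simp
    have e2 : C (b + τ * a - a ^ 2 / 4) = C b + C τ * (2 * C (a / 2)) - C (a / 2) ^ 2 := by
      rw [← e1, ← C_mul, ← C_pow, ← C_add, ← C_sub]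
      congr 1
      field_simp
      ring
    rw [e2, C_sub, e1]
    ring
  have h5 (τ : K) (h : ¬ ((X - C τ) ^ 2 + (C a * X + C b)).Separable) :
      b + τ * a - a ^ 2 / 4 = 0 := by
    have hm : ((X - C (τ - a / 2)) ^ 2 + C (b + τ * a - a ^ 2 / 4)).Monic := by
      refine ((monic_X_sub_C _).pow 2).add_of_left (degree_C_le.trans_lt ?_)
      rw [degree_pow, degree_X_sub_C]
      norm_num
    rw [h3, ← isUnit_disc_iff hm, disc_sq_add_C, isUnit_iff_ne_zero, not_not] at h
    have h4 : (-4 : K) ≠ 0 := by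
      have : (-4 : K) = -(2 * 2) := by norm_num
      rw [this]
      exact neg_ne_zero.2 (mul_ne_zero h2 h2)
    exact (mul_eq_zero.1 h).resolve_left h4
  rw [Finset.card_le_one]
  intro τ hτ τ' hτ'
  have e := h5 τ (Finset.mem_filter.1 hτ).2
  have e' := h5 τ' (Finset.mem_filter.1 hτ').2
  by_cases ha : a = 0
  · subst ha
    simp only [mul_zero, add_zero, ne_eq, OfNat.ofNat_ne_zero, not_false_eq_true, zero_pow,
      zero_div,
      sub_zero] at e
    simp [e] at hA
  · exact mul_right_cancel₀ ha (by linear_combination e - e')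

end GoodLines

section BadLines

open scoped Classical

variable {K : Type*} [Field K] [Fintype K]

lemma card_filter_eval_eq_zero_le {f : K[X]} (hf : f ≠ 0) :
    (Finset.univ.filter fun τ : K => f.eval τ = 0).card ≤ f.natDegree := by
  refine le_trans (Finset.card_le_card fun τ hτ => ?_)
    ((Multiset.toFinset_card_le f.roots).trans (card_roots' f))
  rw [Multiset.mem_toFinset, mem_roots hf]
  exact (Finset.mem_filter.1 hτ).2

lemma card_filter_product_le_left {α β : Type*} {s : Finset α} {t : Finset β} {p : α → β → Prop}
    [∀ a b, Decidable (p a b)] {c : ℕ} (h : ∀ a ∈ s, (t.filter (p a)).card ≤ c) :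
    ((s ×ˢ t).filter fun x => p x.1 x.2).card ≤ s.card * c := by
  rw [Finset.card_filter, Finset.sum_product, ← smul_eq_mul, ← Finset.sum_const]
  refine Finset.sum_le_sum fun a ha => ?_
  rw [← Finset.card_filter]
  exact h a ha

lemma card_filter_product_le_right {α β : Type*} {s : Finset α} {t : Finset β} {p : α → β → Prop}
    [∀ a b, Decidable (p a b)] {c q : ℕ} (h : ∀ b ∈ t, q * (s.filter (p · b)).card ≤ c) :
    q * ((s ×ˢ t).filter fun x => p x.1 x.2).card ≤ t.card * c := by
  rw [Finset.card_filter, Finset.sum_product_right, ← smul_eq_mul t.card, ← Finset.sum_const,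
    Finset.mul_sum]
  refine Finset.sum_le_sum fun b hb => ?_
  rw [← Finset.card_filter]
  exact h b hb

lemma monics_zero : monics K 0 = {1} := by
  ext P
  rw [mem_monics, Finset.mem_singleton]
  exact ⟨fun h => h.1.natDegree_eq_zero.1 h.2, by rintro rfl; simp⟩

lemma card_filter_not_separable_add_le (h2 : (2 : K) ≠ 0) {m : ℕ} {A : K[X]} (hA : A ≠ 0)
    (hdeg : A.natDegree < m + 2) :
    ((monics K m ×ˢ Finset.univ).filter fun x : K[X] × K =>
      A.eval x.2 ≠ 0 ∧ ¬ ((X - C x.2) ^ 2 * x.1 + A).Separable).card ≤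
      2 ^ (m + 4) * Fintype.card K ^ m := by
  have hqpos : 0 < Fintype.card K := Fintype.card_pos
  rcases Nat.eq_zero_or_pos m with rfl | hm
  · refine (card_filter_product_le_left
      (p := fun R τ => A.eval τ ≠ 0 ∧ ¬ ((X - C τ) ^ 2 * R + A).Separable) (c := 1) ?_).trans ?_
    · intro R hR
      rw [monics_zero, Finset.mem_singleton] at hR
      subst hR
      simp only [mul_one]
      refine le_trans (Finset.card_le_card fun τ hτ => ?_) (separable_sq_add h2 hA (by omega))
      simp only [Finset.mem_filter] at hτ ⊢
      exact ⟨hτ.1, hτ.2.2⟩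
    · rw [card_monics]; simp
  · refine Nat.le_of_mul_le_mul_left ?_ hqpos
    refine (card_filter_product_le_right
      (p := fun R τ => A.eval τ ≠ 0 ∧ ¬ ((X - C τ) ^ 2 * R + A).Separable)
      (c := 2 ^ (m + 4) * Fintype.card K ^ m) ?_).trans ?_
    · intro τ _
      refine mul_card_filter_le_of_forall_add hm _ fun R hR => ?_
      by_cases hτ : A.eval τ = 0
      · simp [hτ]
      obtain ⟨hRm, hRd⟩ := mem_monics.1 hR
      set S := (X - C τ) ^ 2 * R + A with hS
      have hSd : S.natDegree ≤ m + 2 := by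
        refine (natDegree_add_le _ _).trans (max_le ?_ hdeg.le)
        refine natDegree_mul_le.trans ?_
        rw [natDegree_pow, natDegree_X_sub_C, hRd]
        omega
      refine le_trans (Finset.card_le_card fun b hb => ?_)
        ((card_not_squarefree_add_mul_sq_le h2 (S := S) (τ := τ) (by simpa [hS] using hτ)).trans
          (Nat.pow_le_pow_right (by norm_num) (by omega)))
      simp only [Finset.mem_filter, Finset.mem_univ, true_and] at hb ⊢
      intro h
      refine hb.2 (PerfectField.separable_iff_squarefree.2 ?_)
      convert h using 1
      rw [hS]
      ring
    · rw [Finset.card_univ]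

/-- The number of bad lines is smaller than the number of all lines by a factor `1 / q`. -/
lemma card_filter_not_isGood_le (h2 : (2 : K) ≠ 0) {m : ℕ} {A : K[X]} (hA : A ≠ 0)
    (hdeg : A.natDegree < m + 2) :
    ((monics K m ×ˢ Finset.univ).filter fun x : K[X] × K => ¬ IsGood A x.1 x.2).card ≤
      (3 * m + 2 + 2 ^ (m + 4)) * Fintype.card K ^ m := by
  have h0 := card_filter_not_separable_add_le h2 hA hdeg
  set q := Fintype.card K with hq
  have hqpos : 0 < q := Fintype.card_pos
  have h1 : ((monics K m ×ˢ Finset.univ).filter fun x : K[X] × K => ¬ x.1.Separable).card ≤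
      m * q ^ m := by
    refine Nat.le_of_mul_le_mul_left ?_ hqpos
    refine (card_filter_product_le_right (p := fun (R : K[X]) (_ : K) => ¬ R.Separable)
      (c := m * q ^ m) fun τ _ => ?_).trans_eq (by rw [Finset.card_univ])
    simp only [PerfectField.separable_iff_squarefree]
    exact card_filter_not_squarefree_le m
  have h3 : ((monics K m ×ˢ Finset.univ).filter fun x : K[X] × K => x.1.eval x.2 = 0).card ≤
      m * q ^ m := by
    refine (card_filter_product_le_left (p := fun (R : K[X]) (τ : K) => R.eval τ = 0)
      (c := m) fun R hR => ?_).trans_eq (by rw [card_monics, mul_comm])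
    have hR' := mem_monics.1 hR
    exact (card_filter_eval_eq_zero_le hR'.1.ne_zero).trans hR'.2.le
  have h4 : ((monics K m ×ˢ Finset.univ).filter fun x : K[X] × K => A.eval x.2 = 0).card ≤
      (m + 2) * q ^ m := by
    refine (card_filter_product_le_left (p := fun (_ : K[X]) (τ : K) => A.eval τ = 0)
      (c := m + 2) fun R hR => ?_).trans_eq (by rw [card_monics, mul_comm])
    exact (card_filter_eval_eq_zero_le hA).trans hdeg.le
  refine le_trans (Finset.card_le_card (t := (((monics K m ×ˢ Finset.univ).filter
    fun x : K[X] × K => ¬ x.1.Separable) ∪ ((monics K m ×ˢ Finset.univ).filter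
    fun x : K[X] × K => x.1.eval x.2 = 0)) ∪ (((monics K m ×ˢ Finset.univ).filter
    fun x : K[X] × K => A.eval x.2 = 0) ∪ ((monics K m ×ˢ Finset.univ).filter
    fun x : K[X] × K => A.eval x.2 ≠ 0 ∧ ¬ ((X - C x.2) ^ 2 * x.1 + A).Separable))) ?_) ?_
  · intro x hx
    obtain ⟨hx, hb⟩ := Finset.mem_filter.1 hx
    simp only [Finset.mem_union, Finset.mem_filter, hx, true_and]
    by_contra! h
    exact hb ⟨h.1.1, h.1.2, h.2.2 h.2.1⟩
  · refine (Finset.card_union_le _ _).trans ((Nat.add_le_add (Finset.card_union_le _ _)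
      (Finset.card_union_le _ _)).trans ?_)
    calc _ ≤ (m * q ^ m + m * q ^ m) + ((m + 2) * q ^ m + 2 ^ (m + 4) * q ^ m) := by gcongr
      _ = _ := by ring

end BadLines

section BadPairs

open scoped Classical

variable {K : Type*} [Field K] [Fintype K]

/-- The line through `(R, τ)` lies in the sieve progression `D₁ ∣ P`, `D₂ ∣ P + A`. -/
def OnLine (A D₁ D₂ R : K[X]) (τ : K) : Prop :=
  D₁ ∣ (X - C τ) ^ 2 * R ∧ D₂ ∣ (X - C τ) ^ 2 * R + A

lemma card_filter_onLine {m d₁ d₂ : ℕ} (A : K[X]) {D₁ D₂ : K[X]} (hc : IsCoprime D₁ D₂)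
    (h₁ : D₁ ∈ monics K d₁) (h₂ : D₂ ∈ monics K d₂) (hm : d₁ + d₂ ≤ m) {τ : K}
    (hτ₁ : D₁.eval τ ≠ 0) (hτ₂ : D₂.eval τ ≠ 0) :
    ((monics K m).filter fun R => OnLine A D₁ D₂ R τ).card = Fintype.card K ^ (m - (d₁ + d₂)) := by
  have hcop {D : K[X]} (hD : D.eval τ ≠ 0) : IsCoprime D ((X - C τ) ^ 2) := by
    refine ((irreducible_X_sub_C τ).coprime_iff_not_dvd.2 ?_).symm.pow_right
    rwa [dvd_iff_isRoot, IsRoot.def]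
  obtain ⟨u, v, huv⟩ := hcop hτ₂
  rw [← card_filter_dvd_dvd (A := v * A) hc h₁ h₂ hm]
  congr 1
  refine Finset.filter_congr fun R _ => and_congr ?_ ?_
  · exact ⟨(hcop hτ₁).dvd_of_dvd_mul_left, fun h => h.mul_left _⟩
  · have : (X - C τ) ^ 2 * R + A = (X - C τ) ^ 2 * (R + v * A) + D₂ * (u * A) := by
      linear_combination (-A) * huv
    rw [this, dvd_add_left (dvd_mul_right _ _)]
    exact ⟨(hcop hτ₂).dvd_of_dvd_mul_left, fun h => h.mul_left _⟩

/-- The progression `D₁ ∣ P`, `D₂ ∣ P + A` contains a good base point of degree `m + 2`. -/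
def HasGoodPoint (m : ℕ) (A D₁ D₂ : K[X]) : Prop :=
  ∃ R ∈ monics K m, ∃ τ : K, OnLine A D₁ D₂ R τ ∧ D₁.eval τ ≠ 0 ∧ D₂.eval τ ≠ 0 ∧ IsGood A R τ

lemma card_filter_not_hasGoodPoint_le (h2 : (2 : K) ≠ 0) {m d₁ d₂ : ℕ} {A : K[X]} (hA : A ≠ 0)
    (hdeg : A.natDegree < m + 2) (hm : d₁ + d₂ ≤ m) (hq : 2 * m ≤ Fintype.card K) :
    Fintype.card K * ((monics K d₁ ×ˢ monics K d₂).filter fun x : K[X] × K[X] =>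
      IsCoprime x.1 x.2 ∧ ¬ HasGoodPoint m A x.1 x.2).card ≤
      2 * 4 ^ (m + 2) * (3 * m + 2 + 2 ^ (m + 4)) * Fintype.card K ^ (d₁ + d₂) := by
  have hbad := card_filter_not_isGood_le h2 hA hdeg
  set q := Fintype.card K with hqdef
  have hqpos : 0 < q := Fintype.card_pos
  set s := (monics K d₁ ×ˢ monics K d₂).filter fun x : K[X] × K[X] =>
      IsCoprime x.1 x.2 ∧ ¬ HasGoodPoint m A x.1 x.2 with hs
  set t := (monics K m ×ˢ Finset.univ).filter fun x : K[X] × K => ¬ IsGood A x.1 x.2 with ht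
  have key := Finset.card_mul_le_card_mul (s := s) (t := t)
    (fun x y => OnLine A x.1 x.2 y.1 y.2) (m := (q - (d₁ + d₂)) * q ^ (m - (d₁ + d₂)))
    (n := 4 ^ (m + 2)) ?_ ?_
  · have h1 : q ≤ 2 * (q - (d₁ + d₂)) := by omega
    refine Nat.le_of_mul_le_mul_right ?_ (pow_pos hqpos (m - (d₁ + d₂)))
    calc q * s.card * q ^ (m - (d₁ + d₂))
        ≤ 2 * (q - (d₁ + d₂)) * s.card * q ^ (m - (d₁ + d₂)) := by gcongr
      _ = 2 * (s.card * ((q - (d₁ + d₂)) * q ^ (m - (d₁ + d₂)))) := by ring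
      _ ≤ 2 * (((3 * m + 2 + 2 ^ (m + 4)) * q ^ m) * 4 ^ (m + 2)) := by
        exact Nat.mul_le_mul_left _ (key.trans (Nat.mul_le_mul_right _ hbad))
      _ = 2 * 4 ^ (m + 2) * (3 * m + 2 + 2 ^ (m + 4)) *
          (q ^ (d₁ + d₂) * q ^ (m - (d₁ + d₂))) := by
        rw [← pow_add, Nat.add_sub_cancel' hm]
        ring
      _ = _ := by ring
  · rintro ⟨D₁, D₂⟩ hx
    obtain ⟨hx, hc, hbadx⟩ := Finset.mem_filter.1 hx
    obtain ⟨h₁, h₂⟩ := Finset.mem_product.1 hx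
    dsimp only at h₁ h₂ hc hbadx
    have h₁' := mem_monics.1 h₁
    have h₂' := mem_monics.1 h₂
    set U := Finset.univ.filter fun τ : K => (D₁ * D₂).eval τ ≠ 0 with hU
    have hUcard : q - (d₁ + d₂) ≤ U.card := by
      have h3 := card_filter_eval_eq_zero_le (h₁'.1.mul h₂'.1).ne_zero
      rw [h₁'.1.natDegree_mul h₂'.1, h₁'.2, h₂'.2] at h3
      have h4 : (Finset.univ.filter fun τ : K => (D₁ * D₂).eval τ = 0).card + U.card = q := by
        rw [hqdef, ← Finset.card_univ]
        convert Finset.card_filter_add_card_filter_not (s := (Finset.univ : Finset K))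
          (fun τ : K => (D₁ * D₂).eval τ = 0)
      omega
    calc (q - (d₁ + d₂)) * q ^ (m - (d₁ + d₂)) ≤ U.card * q ^ (m - (d₁ + d₂)) := by gcongr
      _ = ((monics K m ×ˢ U).filter fun y : K[X] × K => OnLine A D₁ D₂ y.1 y.2).card := by
        rw [Finset.card_filter (fun y : K[X] × K => OnLine A D₁ D₂ y.1 y.2),
          Finset.sum_product_right, ← smul_eq_mul U.card,
          ← Finset.sum_const]
        refine Finset.sum_congr rfl fun τ hτ => ?_
        rw [← Finset.card_filter]
        have hτ' := (Finset.mem_filter.1 hτ).2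
        rw [eval_mul] at hτ'
        exact (card_filter_onLine A hc h₁ h₂ hm (left_ne_zero_of_mul hτ')
          (right_ne_zero_of_mul hτ')).symm
      _ ≤ _ := by
        refine Finset.card_le_card ?_
        rintro ⟨R, τ⟩ hy
        obtain ⟨hy, hl⟩ := Finset.mem_filter.1 hy
        obtain ⟨hR, hτ⟩ := Finset.mem_product.1 hy
        have hτ' := (Finset.mem_filter.1 hτ).2
        rw [eval_mul] at hτ'
        rw [Finset.mem_bipartiteAbove]
        refine ⟨Finset.mem_filter.2 ⟨Finset.mem_product.2 ⟨hR, Finset.mem_univ _⟩,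
          fun hg => ?_⟩, hl⟩
        exact hbadx ⟨R, hR, τ, hl, left_ne_zero_of_mul hτ', right_ne_zero_of_mul hτ', hg⟩
  · rintro ⟨R, τ⟩ hy
    obtain ⟨hy, -⟩ := Finset.mem_filter.1 hy
    obtain ⟨hRm, hRd⟩ := mem_monics.1 (Finset.mem_product.1 hy).1
    dsimp only at hRm hRd
    have hP : (X - C τ) ^ 2 * R ∈ monics K (m + 2) := by
      rw [mem_monics]
      refine ⟨((monic_X_sub_C τ).pow 2).mul hRm, ?_⟩
      rw [((monic_X_sub_C τ).pow 2).natDegree_mul hRm, natDegree_pow, natDegree_X_sub_C, hRd]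
      omega
    have hPA := mem_monics.1 (add_mem_monics hP (A := A)
      ((degree_le_natDegree).trans_lt (by exact_mod_cast hdeg)))
    have hP' := mem_monics.1 hP
    have h3 : s.bipartiteBelow (fun x y => OnLine A x.1 x.2 y.1 y.2) (R, τ) ⊆
        divs ((X - C τ) ^ 2 * R) ×ˢ divs ((X - C τ) ^ 2 * R + A) := by
      rintro ⟨D₁, D₂⟩ hx
      rw [Finset.mem_bipartiteBelow] at hx
      obtain ⟨hx, hl⟩ := hx
      obtain ⟨h₁, h₂⟩ := Finset.mem_product.1 (Finset.mem_filter.1 hx).1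
      rw [Finset.mem_product, mem_divs hP'.1.ne_zero, mem_divs hPA.1.ne_zero]
      exact ⟨⟨(mem_monics.1 h₁).1, hl.1⟩, (mem_monics.1 h₂).1, hl.2⟩
    refine (Finset.card_le_card h3).trans ?_
    rw [Finset.card_product]
    refine (Nat.mul_le_mul (card_divs_le hP'.1.ne_zero) (card_divs_le hPA.1.ne_zero)).trans_eq ?_
    rw [hP'.2, hPA.2, ← mul_pow]
    norm_num

end BadPairs

section ProgressionSums

open scoped Classical

variable {K : Type*} [Field K] [Fintype K]

lemma card_filter_lowDeg_eval_eq_zero_le {h : ℕ} (hh : 0 < h) (τ : K) :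
    ((lowDeg K h).filter fun L => L.eval τ = 0).card * Fintype.card K ≤ Fintype.card K ^ h := by
  rw [← card_lowDeg (K := K) h, ← Finset.card_univ, ← Finset.card_product]
  refine Finset.card_le_card_of_injOn (fun x => x.1 + C x.2) ?_ ?_
  · rintro ⟨L, c⟩ hx
    have hL := (Finset.mem_filter.1 (Finset.mem_product.1 hx).1).1
    exact mem_lowDeg.2 ((degree_add_le _ _).trans_lt (max_lt (mem_lowDeg.1 hL)
      (degree_C_le.trans_lt (by exact_mod_cast hh))))
  · rintro ⟨L, c⟩ hx ⟨L', c'⟩ hx' heq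
    have hL := (Finset.mem_filter.1 (Finset.mem_product.1 hx).1).2
    have hL' := (Finset.mem_filter.1 (Finset.mem_product.1 hx').1).2
    dsimp only at heq hL hL'
    have hc : c = c' := by simpa [hL, hL'] using congrArg (eval τ) heq
    subst hc
    simpa using heq

lemma sum_lowDeg_C_mul {h : ℕ} {b : K} (hb : b ≠ 0) (f : K[X] → ℝ) :
    ∑ L ∈ lowDeg K h, f (C b * L) = ∑ L ∈ lowDeg K h, f L := by
  have hmem (c : K) (L : K[X]) (hL : L ∈ lowDeg K h) : C c * L ∈ lowDeg K h :=
    mem_lowDeg.2 (by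
      rw [← smul_eq_C_mul]
      exact (degree_smul_le c L).trans_lt (mem_lowDeg.1 hL))
  refine Finset.sum_bij' (fun L _ => C b * L) (fun L _ => C b⁻¹ * L) (fun L hL => hmem _ L hL)
    (fun L hL => hmem _ L hL) (fun L _ => ?_) (fun L _ => ?_) (fun L _ => rfl)
  · rw [← mul_assoc, ← C_mul, inv_mul_cancel₀ hb, C_1, one_mul]
  · rw [← mul_assoc, ← C_mul, mul_inv_cancel₀ hb, C_1, one_mul]

lemma sum_lowDeg_sum_line {h : ℕ} (φ : K[X] → ℝ) (P G : K[X]) :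
    ∑ L ∈ lowDeg K h, ∑ b : K, φ (P + C b * (G * L)) =
      (Fintype.card K - 1) * ∑ L ∈ lowDeg K h, φ (P + G * L) + Fintype.card K ^ h * φ P := by
  rw [Finset.sum_comm, Fintype.sum_eq_add_sum_compl (0 : K), add_comm]
  congr 1
  · have h1 : ∀ b ∈ ({0}ᶜ : Finset K), ∑ L ∈ lowDeg K h, φ (P + C b * (G * L)) =
        ∑ L ∈ lowDeg K h, φ (P + G * L) := by
      intro b hb
      rw [← sum_lowDeg_C_mul (b := b) (by simpa using hb) fun L => φ (P + G * L)]
      refine Finset.sum_congr rfl fun L _ => ?_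
      congr 2
      ring
    rw [Finset.sum_congr rfl h1, Finset.sum_const, Finset.card_compl, Finset.card_singleton,
      nsmul_eq_mul, Nat.cast_sub Fintype.card_pos, Nat.cast_one]
  · simp [card_lowDeg]

/-- Cancellation over a progression, provided that all lines through some base point which avoid a
zero at `τ` show cancellation. -/
lemma abs_sum_lowDeg_le {h : ℕ} (hh : 0 < h) {φ : K[X] → ℝ} (hφ : ∀ P, |φ P| ≤ 1) {P G : K[X]}
    {τ : K} {ε : ℝ} (hq : 2 ≤ ε * Fintype.card K)
    (hline : ∀ L ∈ lowDeg K h, L.eval τ ≠ 0 →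
      |∑ b : K, φ (P + C b * (G * L))| ≤ ε * Fintype.card K) :
    |∑ L ∈ lowDeg K h, φ (P + G * L)| ≤ 4 * ε * Fintype.card K ^ h := by
  have hz := card_filter_lowDeg_eval_eq_zero_le hh τ
  have hsum := sum_lowDeg_sum_line (h := h) φ P G
  set T := ∑ L ∈ lowDeg K h, φ (P + G * L) with hT
  have hq2 : (2 : ℝ) ≤ Fintype.card K := by exact_mod_cast Fintype.one_lt_card (α := K)
  have hzR : (((lowDeg K h).filter fun L => L.eval τ = 0).card : ℝ) * Fintype.card K ≤
    (Fintype.card K : ℝ) ^ h := by exact_mod_cast hz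
  set q := (Fintype.card K : ℝ) with hqdef
  have hqh : 0 < q ^ h := by positivity
  have h1 : |∑ L ∈ lowDeg K h, ∑ b : K, φ (P + C b * (G * L))| ≤ q ^ h * (ε * q) + q ^ h := by
    calc _ ≤ ∑ L ∈ lowDeg K h, |∑ b : K, φ (P + C b * (G * L))| :=
          Finset.abs_sum_le_sum_abs _ _
      _ ≤ ∑ L ∈ lowDeg K h, (ε * q + if L.eval τ = 0 then q else 0) := by
          refine Finset.sum_le_sum fun L hL => ?_
          split_ifs with h0
          · have : |∑ b : K, φ (P + C b * (G * L))| ≤ q := by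
              refine (Finset.abs_sum_le_sum_abs _ _).trans
                ((Finset.sum_le_sum fun b _ => hφ _).trans_eq ?_)
              simp [hqdef]
            linarith
          · rw [add_zero]
            exact hline L hL h0
      _ = q ^ h * (ε * q) + ((lowDeg K h).filter fun L => L.eval τ = 0).card * q := by
          rw [Finset.sum_add_distrib, Finset.sum_const, card_lowDeg, ← Finset.sum_filter,
            Finset.sum_const, nsmul_eq_mul, nsmul_eq_mul]
          push_cast
          rfl
      _ ≤ _ := by gcongr
  have h2 : |(q - 1) * T| ≤ q ^ h * (2 * (ε * q)) := by
    have h3 : (q - 1) * T = ∑ L ∈ lowDeg K h, ∑ b : K, φ (P + C b * (G * L)) - q ^ h * φ P := by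
      rw [hsum]; ring
    rw [h3]
    refine (abs_sub _ _).trans ?_
    rw [abs_mul, abs_of_pos hqh]
    nlinarith [hφ P]
  rw [abs_mul, abs_of_pos (by linarith)] at h2
  have h3 : q / 2 * |T| ≤ (q - 1) * |T| := by
    gcongr
    linarith
  have h4 : q / 2 * |T| ≤ q / 2 * (4 * ε * q ^ h) := by nlinarith
  exact le_of_mul_le_mul_left h4 (by linarith)

end ProgressionSums

section TwistedProgressions

open scoped Classical

variable {K : Type*} [Field K] [Fintype K] [DecidableEq K]

lemma abs_sum_filter_mob_le {m d₁ d₂ : ℕ} {ε : ℝ} (hB : CharacterSumBound K (4 * (m + 2)) ε)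
    (h2 : (2 : K) ≠ 0) (hq : 2 ≤ ε * Fintype.card K)
    {ψ : K[X] → ℝ} (hψ : ψ = (fun _ => 1) ∨ ψ = mob) {A D₁ D₂ : K[X]}
    (hA : A.natDegree < m + 2) (hc : IsCoprime D₁ D₂)
    (h₁ : D₁ ∈ monics K d₁) (h₂ : D₂ ∈ monics K d₂) (hm : d₁ + d₂ ≤ m)
    (hgood : HasGoodPoint m A D₁ D₂) :
    |∑ P ∈ (monics K (m + 2)).filter (fun P => D₁ ∣ P ∧ D₂ ∣ P + A), mob P * ψ (P + A)| ≤
      4 * ε * Fintype.card K ^ (m + 2 - (d₁ + d₂)) := by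
  obtain ⟨R, hR, τ, hl, hτ₁, hτ₂, hsep, hRτ, hsepA⟩ := hgood
  obtain ⟨hRm, hRd⟩ := mem_monics.1 hR
  obtain ⟨a, ha⟩ := exists_crt hc A
  have hPm : ((X - C τ) ^ 2 * R).Monic := ((monic_X_sub_C τ).pow 2).mul hRm
  have hPd : ((X - C τ) ^ 2 * R).natDegree = m + 2 := by
    rw [((monic_X_sub_C τ).pow 2).natDegree_mul hRm, natDegree_pow, natDegree_X_sub_C, hRd]
    omega
  have hPd' : ((X - C τ) ^ 2 * R).degree = ((m + 2 : ℕ) : WithBot ℕ) := by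
    rw [degree_eq_natDegree hPm.ne_zero, hPd]
  have hG := mul_mem_monics h₁ h₂
  have hdvd : D₁ * D₂ ∣ (X - C τ) ^ 2 * R - a := (ha _).1 hl
  rw [Finset.filter_congr fun P _ => ha P,
    sum_filter_dvd_sub hG (by omega) (mem_monics.2 ⟨hPm, hPd⟩) hdvd fun P => mob P * ψ (P + A)]
  have hψ1 (P : K[X]) : |ψ P| ≤ 1 := by
    rcases hψ with rfl | rfl
    · simp
    · exact abs_mob_le_one P
  refine abs_sum_lowDeg_le (by omega) (τ := τ) (φ := fun P => mob P * ψ (P + A)) (fun P => ?_) hq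
    fun L hL hLτ => ?_
  · rw [abs_mul]
    exact mul_le_one₀ (abs_mob_le_one P) (abs_nonneg _) (hψ1 _)
  · have hL0 : L ≠ 0 := by rintro rfl; simp at hLτ
    refine abs_sum_mob_line_le (N := D₁ * D₂ * L) hB h2 hψ τ hRm hsep hRτ hPd ?_ hsepA ?_ ?_
    · rw [hPd']
      exact degree_le_natDegree.trans_lt (by exact_mod_cast hA)
    · have hL' := mem_lowDeg.1 hL
      obtain ⟨hGm, hGd⟩ := mem_monics.1 hG
      rw [hPd', degree_mul, degree_eq_natDegree hGm.ne_zero, degree_eq_natDegree hL0, hGd]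
      rw [degree_eq_natDegree hL0] at hL'
      norm_cast at hL' ⊢
      omega
    · rw [eval_mul, eval_mul]
      exact mul_ne_zero (mul_ne_zero hτ₁ hτ₂) hLτ

end TwistedProgressions

section Sieve

open scoped Classical

variable {K : Type*} [Field K] [Fintype K] [DecidableEq K]

lemma sum_divs_mul (hodd : Odd (Fintype.card K)) {π Q : K[X]} (hm : π.Monic)
    (hi : Irreducible π) (hQ : Q.Monic) (w : K[X] → ℝ) :
    ∑ D ∈ divs (π * Q), mob D * w D =
      ∑ D ∈ (divs Q).filter (fun D => ¬ π ∣ D), mob D * (w D - w (π * D)) := by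
  have hP0 := (hm.mul hQ).ne_zero
  rw [← Finset.sum_filter_not_add_sum_filter (divs (π * Q)) (fun D => π ∣ D)]
  have h1 : (divs (π * Q)).filter (fun D => ¬ π ∣ D) = (divs Q).filter (fun D => ¬ π ∣ D) := by
    ext D
    simp only [Finset.mem_filter, mem_divs hP0, mem_divs hQ.ne_zero]
    refine and_congr_left fun h => and_congr_right fun _ => ⟨fun hd => ?_, fun hd => hd.mul_left _⟩
    exact (hi.coprime_iff_not_dvd.2 h).symm.dvd_of_dvd_mul_left hd
  have h2 : (divs (π * Q)).filter (fun D => π ∣ D) = (divs Q).image (π * ·) := by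
    ext D
    simp only [Finset.mem_filter, Finset.mem_image, mem_divs hP0, mem_divs hQ.ne_zero]
    constructor
    · rintro ⟨⟨hD, hd⟩, h⟩
      obtain ⟨E, hE, rfl⟩ := exists_eq_mul_of_irreducible_dvd hm h hD
      exact ⟨E, ⟨hE, (mul_dvd_mul_iff_left hm.ne_zero).1 hd⟩, rfl⟩
    · rintro ⟨E, ⟨hE, hd⟩, rfl⟩
      exact ⟨⟨hm.mul hE, mul_dvd_mul_left π hd⟩, dvd_mul_right _ _⟩
  rw [h1, h2, Finset.sum_image fun E _ E' _ h => mul_left_cancel₀ hm.ne_zero h]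
  have h3 : ∑ E ∈ divs Q, mob (π * E) * w (π * E) =
      ∑ E ∈ (divs Q).filter (fun D => ¬ π ∣ D), -(mob E * w (π * E)) := by
    rw [Finset.sum_filter]
    refine Finset.sum_congr rfl fun E hE => ?_
    have hE := ((mem_divs hQ.ne_zero).1 hE).1
    split_ifs with h
    · rw [(mob_eq_zero_iff (hm.mul hE)).2, zero_mul]
      exact fun hs => hi.not_isUnit (hs.squarefree π (mul_dvd_mul_left π h))
    · rw [mob_mul hm hE (hi.coprime_iff_not_dvd.2 h), mob_of_irreducible hodd hi hm]
      ring
  rw [h3, ← Finset.sum_add_distrib]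
  refine Finset.sum_congr rfl fun D _ => ?_
  ring

lemma exists_eq_mul_of_ne_one {K : Type*} [Field K] {P : K[X]} (hP : P.Monic) (h1 : P ≠ 1) :
    ∃ π Q : K[X], π.Monic ∧ Irreducible π ∧ Q.Monic ∧ P = π * Q := by
  obtain ⟨π, hm, hi, hd⟩ := exists_monic_irreducible_dvd
    (fun h => h1 (hP.eq_one_of_isUnit h)) hP.ne_zero
  obtain ⟨Q, hQ, rfl⟩ := exists_eq_mul_of_irreducible_dvd hm hd hP
  exact ⟨π, Q, hm, hi, hQ, rfl⟩

lemma sum_divs_mob (hodd : Odd (Fintype.card K)) {P : K[X]} (hP : P.Monic) (h1 : P ≠ 1) :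
    ∑ D ∈ divs P, mob D = 0 := by
  obtain ⟨π, Q, hm, hi, hQ, rfl⟩ := exists_eq_mul_of_ne_one hP h1
  simpa using sum_divs_mul hodd hm hi hQ fun _ => 1

lemma sum_divs_mob_mul_degree (hodd : Odd (Fintype.card K)) {P : K[X]} (hP : P.Monic)
    (h1 : P ≠ 1) (hirr : ¬ Irreducible P) (hs : Squarefree P) (N : ℝ) :
    ∑ D ∈ divs P, mob D * (N - D.natDegree) = 0 := by
  obtain ⟨π, Q, hm, hi, hQ, rfl⟩ := exists_eq_mul_of_ne_one hP h1
  have hQ1 : Q ≠ 1 := by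
    rintro rfl
    exact hirr (by rwa [mul_one])
  have hπQ : ¬ π ∣ Q := fun h => hi.not_isUnit (hs π (mul_dvd_mul_left π h))
  rw [sum_divs_mul hodd hm hi hQ, Finset.filter_true_of_mem]
  · have h2 : ∀ D ∈ divs Q, mob D * ((N - D.natDegree) - (N - (π * D).natDegree)) =
        mob D * π.natDegree := by
      intro D hD
      rw [hm.natDegree_mul ((mem_divs hQ.ne_zero).1 hD).1]
      push_cast
      ring
    rw [Finset.sum_congr rfl h2, ← Finset.sum_mul, sum_divs_mob hodd hQ hQ1, zero_mul]
  · exact fun D hD h => hπQ (h.trans ((mem_divs hQ.ne_zero).1 hD).2)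

/-- A Möbius sum over the divisors of degree less than `N`, with linear weights. -/
noncomputable def sieve (N : ℕ) (P : K[X]) : ℝ :=
  ∑ D ∈ divs P, mob D * ((N - D.natDegree : ℕ) : ℝ)

lemma sum_divs_complement {K : Type*} [Field K] [Fintype K] {P : K[X]} (hP : P.Monic)
    (f : K[X] → K[X] → ℝ) :
    ∑ D ∈ divs P, f D (P / D) = ∑ D ∈ divs P, f (P / D) D := by
  have hmul (D : K[X]) (hD : D ∈ divs P) : D * (P / D) = P := by
    rw [mem_divs hP.ne_zero] at hD
    exact EuclideanDomain.mul_div_cancel' hD.1.ne_zero hD.2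
  have hmem (D : K[X]) (hD : D ∈ divs P) : P / D ∈ divs P := by
    have h := hmul D hD
    rw [mem_divs hP.ne_zero] at hD ⊢
    exact ⟨hD.1.of_mul_monic_left (by rwa [h]), ⟨D, by rw [mul_comm, h]⟩⟩
  have hinv (D : K[X]) (hD : D ∈ divs P) : P / (P / D) = D := by
    have h1 := hmul D hD
    have h2 := hmul _ (hmem D hD)
    have h3 : P / D ≠ 0 := ((mem_divs hP.ne_zero).1 (hmem D hD)).1.ne_zero
    exact mul_left_cancel₀ h3 (by rw [h2, mul_comm, h1])
  exact Finset.sum_bij' (fun D _ => P / D) (fun D _ => P / D) hmem hmem hinv hinv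
    fun D hD => by rw [hinv D hD]

/-- The sieve weight vanishes on reducible squarefree polynomials. -/
lemma sieve_sub_mob_mul_sieve (hodd : Odd (Fintype.card K)) {n : ℕ} {P : K[X]}
    (hP : P ∈ monics K n) (hn : 0 < n) (hirr : ¬ Irreducible P) (hs : Squarefree P) :
    sieve ((n + 1) / 2) P - mob P * sieve (n / 2) P = 0 := by
  obtain ⟨hm, hd⟩ := mem_monics.1 hP
  have h1 : P ≠ 1 := by
    rintro rfl
    rw [natDegree_one] at hd
    omega
  have h0 := sum_divs_mob_mul_degree hodd hm h1 hirr hs ((n + 1) / 2 : ℕ)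
  rw [← h0]
  have h2 : mob P * sieve (n / 2) P =
      ∑ D ∈ divs P, mob D * ((D.natDegree - (n + 1) / 2 : ℕ) : ℝ) := by
    have := sum_divs_complement hm fun D E => mob D * ((D.natDegree - (n + 1) / 2 : ℕ) : ℝ)
    rw [this, sieve, Finset.mul_sum]
    refine Finset.sum_congr rfl fun D hD => ?_
    replace hD := (mem_divs hm.ne_zero).1 hD
    obtain ⟨hD, E, rfl⟩ := hD
    have hE : E.Monic := hD.of_mul_monic_left hm
    have hcop : IsCoprime D E := by
      rw [← isRelPrime_iff_isCoprime]
      exact IsRelPrime.of_squarefree_mul hs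
    rw [mul_div_cancel_left₀ _ hD.ne_zero, mob_mul hD hE hcop]
    rw [hD.natDegree_mul hE] at hd
    have h3 : n / 2 - D.natDegree = E.natDegree - (n + 1) / 2 := by omega
    have h4 : mob D * mob D = 1 := by
      have h5 : mob D ≠ 0 := by
        rw [Ne, mob_eq_zero_iff hD, not_not, PerfectField.separable_iff_squarefree]
        exact hs.of_mul_left
      rw [mob] at h5 ⊢
      have h6 : disc D ≠ 0 := by
        intro h
        simp [h] at h5
      have h7 := quadraticChar_sq_one h6
      have h8 : ((quadraticChar K (disc D) : ℤ) : ℝ) ^ 2 = 1 := by exact_mod_cast h7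
      rw [← pow_two, mul_pow, h8, mul_one, ← pow_mul, mul_comm, pow_mul, neg_one_sq, one_pow]
    rw [h3]
    linear_combination (mob E * ((E.natDegree - (n + 1) / 2 : ℕ) : ℝ)) * h4
  rw [h2, sieve, ← Finset.sum_sub_distrib]
  refine Finset.sum_congr rfl fun D _ => ?_
  rw [← mul_sub]
  congr 1
  rcases le_total D.natDegree ((n + 1) / 2) with h | h
  · rw [Nat.sub_eq_zero_of_le h, Nat.cast_sub h]; simp
  · rw [Nat.sub_eq_zero_of_le h, Nat.cast_sub h]; simp

lemma sieve_eq_sum {N : ℕ} {P : K[X]} (hP : P ≠ 0) :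
    sieve N P = ∑ d ∈ Finset.range N, ∑ D ∈ monics K d,
      if D ∣ P then mob D * ((N - d : ℕ) : ℝ) else 0 := by
  have h1 : sieve N P = ∑ D ∈ (divs P).filter (fun D => D.natDegree ∈ Finset.range N),
      mob D * ((N - D.natDegree : ℕ) : ℝ) := by
    rw [sieve, Finset.sum_filter]
    refine Finset.sum_congr rfl fun D _ => ?_
    split_ifs with h
    · rfl
    · rw [Finset.mem_range, not_lt] at h
      simp [Nat.sub_eq_zero_of_le h]
  rw [h1, ← Finset.sum_fiberwise_of_maps_to (t := Finset.range N) (g := natDegree)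
    fun D hD => (Finset.mem_filter.1 hD).2]
  refine Finset.sum_congr rfl fun d hd => ?_
  rw [← Finset.sum_filter]
  refine Finset.sum_congr ?_ fun D hD => ?_
  · ext D
    simp only [Finset.mem_filter, mem_divs hP, mem_monics]
    constructor
    · rintro ⟨⟨⟨h, h'⟩, _⟩, h''⟩
      exact ⟨⟨h, h''⟩, h'⟩
    · rintro ⟨⟨h, rfl⟩, h'⟩
      exact ⟨⟨⟨h, h'⟩, hd⟩, rfl⟩
  · rw [(mem_monics.1 (Finset.mem_filter.1 hD).1).2]

lemma abs_sieve_le (N : ℕ) {P : K[X]} (hP : P ≠ 0) : |sieve N P| ≤ 2 ^ P.natDegree * N := by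
  rw [sieve]
  refine (Finset.abs_sum_le_sum_abs _ _).trans ?_
  calc _ ≤ ∑ D ∈ divs P, (N : ℝ) := by
        refine Finset.sum_le_sum fun D _ => ?_
        rw [abs_mul, Nat.abs_cast]
        refine (mul_le_of_le_one_left (Nat.cast_nonneg _) (abs_mob_le_one D)).trans ?_
        exact_mod_cast Nat.sub_le _ _
    _ = (divs P).card * (N : ℝ) := by simp
    _ ≤ _ := by
        gcongr
        exact_mod_cast card_divs_le hP

/-- The average of `mob` over the monic polynomials of degree `d`. -/
noncomputable def mobMean (K : Type*) [Field K] [Fintype K] [DecidableEq K] (d : ℕ) : ℝ :=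
  (∑ D ∈ monics K d, mob D) / (Fintype.card K : ℝ) ^ d

lemma sum_mobMean (hodd : Odd (Fintype.card K)) (m : ℕ) :
    ∑ d ∈ Finset.range (m + 1), mobMean K d = if m = 0 then 1 else 0 := by
  rcases Nat.eq_zero_or_pos m with rfl | hm
  · simp [mobMean, monics_zero, mob_one]
  rw [if_neg hm.ne']
  have hq : (Fintype.card K : ℝ) ≠ 0 := by exact_mod_cast Fintype.card_ne_zero
  have h1 : ∑ P ∈ monics K m, ∑ D ∈ divs P, mob D = 0 := by
    refine Finset.sum_eq_zero fun P hP => ?_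
    obtain ⟨hPm, hPd⟩ := mem_monics.1 hP
    refine sum_divs_mob hodd hPm ?_
    rintro rfl
    rw [natDegree_one] at hPd
    omega
  have h2 : ∀ P ∈ monics K m, ∑ D ∈ divs P, mob D =
      ∑ d ∈ Finset.range (m + 1), ∑ D ∈ monics K d, if D ∣ P then mob D else 0 := by
    intro P hP
    obtain ⟨hPm, hPd⟩ := mem_monics.1 hP
    rw [← Finset.sum_fiberwise_of_maps_to (t := Finset.range (m + 1)) (g := natDegree)
      fun D hD => ?_]
    · refine Finset.sum_congr rfl fun d hd => ?_
      rw [← Finset.sum_filter]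
      refine Finset.sum_congr ?_ fun D _ => rfl
      ext D
      simp only [Finset.mem_filter, mem_divs hPm.ne_zero, mem_monics]
      tauto
    · have := natDegree_le_of_dvd ((mem_divs hPm.ne_zero).1 hD).2 hPm.ne_zero
      rw [Finset.mem_range]
      omega
  rw [Finset.sum_congr rfl h2, Finset.sum_comm] at h1
  have h3 : ∀ d ∈ Finset.range (m + 1), mobMean K d * (Fintype.card K : ℝ) ^ m =
      ∑ P ∈ monics K m, ∑ D ∈ monics K d, if D ∣ P then mob D else 0 := by
    intro d hd
    rw [Finset.mem_range] at hd
    rw [Finset.sum_comm, mobMean, ← Nat.sub_add_cancel (Nat.le_of_lt_succ hd), pow_add,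
      Nat.sub_add_cancel (Nat.le_of_lt_succ hd)]
    rw [div_mul_eq_mul_div, mul_div_assoc, mul_div_cancel_right₀ _ (pow_ne_zero _ hq),
      Finset.sum_mul]
    refine Finset.sum_congr rfl fun D hD => ?_
    rw [← Finset.sum_filter, Finset.sum_const, card_filter_dvd hD (Nat.le_of_lt_succ hd),
      nsmul_eq_mul, mul_comm]
    push_cast
    rfl
  rw [← Finset.sum_congr rfl h3, ← Finset.sum_mul] at h1
  exact (mul_eq_zero.1 h1).resolve_right (pow_ne_zero _ hq)

lemma sum_mul_mobMean (hodd : Odd (Fintype.card K)) (N : ℕ) :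
    ∑ d ∈ Finset.range (N + 1), ((N + 1 - d : ℕ) : ℝ) * mobMean K d = 1 := by
  induction N with
  | zero => simpa using sum_mobMean (K := K) hodd 0
  | succ N ih =>
    have h1 : ∀ d ∈ Finset.range (N + 1 + 1), ((N + 1 + 1 - d : ℕ) : ℝ) * mobMean K d =
        ((N + 1 - d : ℕ) : ℝ) * mobMean K d + mobMean K d := by
      intro d hd
      rw [Finset.mem_range] at hd
      rw [show N + 1 + 1 - d = (N + 1 - d) + 1 by omega]
      push_cast
      ring
    rw [Finset.sum_congr rfl h1, Finset.sum_add_distrib, sum_mobMean hodd, Finset.sum_range_succ,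
      ih]
    simp

end Sieve

section Correlations

open scoped Classical

variable {K : Type*} [Field K] [Fintype K]

/-- The sum of `φ` over the monic `P` of degree `n` with `D₁ ∣ P` and `D₂ ∣ P + A`. -/
noncomputable def progSum (φ : K[X] → ℝ) (n : ℕ) (A D₁ D₂ : K[X]) : ℝ :=
  ∑ P ∈ (monics K n).filter (fun P => D₁ ∣ P ∧ D₂ ∣ P + A), φ P

lemma abs_progSum_le {φ : K[X] → ℝ} (hφ : ∀ P, |φ P| ≤ 1) (n : ℕ) (A D₁ D₂ : K[X]) :
    |progSum φ n A D₁ D₂| ≤ ((monics K n).filter (fun P => D₁ ∣ P ∧ D₂ ∣ P + A)).card := by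
  refine (Finset.abs_sum_le_sum_abs _ _).trans ((Finset.sum_le_sum fun P _ => hφ P).trans_eq ?_)
  simp

lemma mul_sum_card_not_isCoprime_le {n : ℕ} (d₁ d₂ : ℕ) {A : K[X]} (hA : A ≠ 0)
    (hdeg : A.natDegree < n) :
    Fintype.card K * ∑ x ∈ (monics K d₁ ×ˢ monics K d₂).filter (fun x => ¬ IsCoprime x.1 x.2),
      ((monics K n).filter (fun P => x.1 ∣ P ∧ x.2 ∣ P + A)).card ≤ 8 ^ n * Fintype.card K ^ n := by
  set s := (monics K d₁ ×ˢ monics K d₂).filter (fun x => ¬ IsCoprime x.1 x.2) with hs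
  have h1 : ∑ x ∈ s, ((monics K n).filter (fun P => x.1 ∣ P ∧ x.2 ∣ P + A)).card ≤
      ((monics K n).filter (fun P => ¬ IsCoprime P A)).card * 4 ^ n := by
    calc _ = ∑ P ∈ monics K n, (s.filter fun x => x.1 ∣ P ∧ x.2 ∣ P + A).card := by
          simp only [Finset.card_filter]
          exact Finset.sum_comm
      _ ≤ ∑ P ∈ monics K n, if ¬ IsCoprime P A then 4 ^ n else 0 := by
          refine Finset.sum_le_sum fun P hP => ?_
          have hP' := mem_monics.1 hP
          have hPA := mem_monics.1 (add_mem_monics hP (A := A)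
            ((degree_le_natDegree).trans_lt (by exact_mod_cast hdeg)))
          by_cases hc : ¬ IsCoprime P A
          · rw [if_pos hc]
            have h3 : (s.filter fun x => x.1 ∣ P ∧ x.2 ∣ P + A) ⊆ divs P ×ˢ divs (P + A) := by
              intro x hx
              obtain ⟨hx, hd⟩ := Finset.mem_filter.1 hx
              obtain ⟨h₁, h₂⟩ := Finset.mem_product.1 (Finset.mem_filter.1 hx).1
              rw [Finset.mem_product, mem_divs hP'.1.ne_zero, mem_divs hPA.1.ne_zero]
              exact ⟨⟨(mem_monics.1 h₁).1, hd.1⟩, (mem_monics.1 h₂).1, hd.2⟩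
            refine (Finset.card_le_card h3).trans ?_
            rw [Finset.card_product]
            refine (Nat.mul_le_mul (card_divs_le hP'.1.ne_zero)
              (card_divs_le hPA.1.ne_zero)).trans_eq ?_
            rw [hP'.2, hPA.2, ← mul_pow]
            norm_num
          · rw [if_neg hc, Nat.le_zero, Finset.card_eq_zero, Finset.filter_eq_empty_iff]
            rintro x hx ⟨hd₁, hd₂⟩
            refine (Finset.mem_filter.1 hx).2 ?_
            rw [not_not] at hc
            have : IsCoprime P (P + A) := by
              simpa [add_comm] using hc.add_mul_left_right 1
            exact this.of_isCoprime_of_dvd_left hd₁ |>.of_isCoprime_of_dvd_right hd₂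
      _ = _ := by rw [← Finset.sum_filter, Finset.sum_const, smul_eq_mul]
  calc _ ≤ Fintype.card K * (((monics K n).filter (fun P => ¬ IsCoprime P A)).card * 4 ^ n) :=
        Nat.mul_le_mul_left _ h1
    _ = (Fintype.card K * ((monics K n).filter (fun P => ¬ IsCoprime P A)).card) * 4 ^ n := by ring
    _ ≤ (2 ^ A.natDegree * Fintype.card K ^ n) * 4 ^ n :=
        Nat.mul_le_mul_right _ (card_filter_not_isCoprime_le n hA)
    _ ≤ (2 ^ n * Fintype.card K ^ n) * 4 ^ n := by gcongr; norm_num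
    _ = _ := by
        rw [show (8 : ℕ) = 2 * 4 by norm_num, mul_pow]
        ring

lemma card_filter_not_isCoprime_pair_le (d₁ d₂ : ℕ) :
    Fintype.card K * ((monics K d₁ ×ˢ monics K d₂).filter (fun x => ¬ IsCoprime x.1 x.2)).card ≤
      2 ^ d₂ * Fintype.card K ^ (d₁ + d₂) := by
  refine (card_filter_product_le_right (p := fun D₁ D₂ : K[X] => ¬ IsCoprime D₁ D₂)
    (c := 2 ^ d₂ * Fintype.card K ^ d₁) fun D hD => ?_).trans_eq ?_
  · obtain ⟨hm, rfl⟩ := mem_monics.1 hD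
    exact card_filter_not_isCoprime_le d₁ hm.ne_zero
  · rw [card_monics]; ring

variable [DecidableEq K]

lemma sum_mul_sieve_mul_sieve (φ : K[X] → ℝ) {n : ℕ} (N₁ N₂ : ℕ) {A : K[X]} (hA : A.natDegree < n) :
    ∑ P ∈ monics K n, φ P * sieve N₁ P * sieve N₂ (P + A) =
      ∑ d ∈ Finset.range N₁ ×ˢ Finset.range N₂, ((N₁ - d.1 : ℕ) : ℝ) * ((N₂ - d.2 : ℕ) : ℝ) *
        ∑ x ∈ monics K d.1 ×ˢ monics K d.2, mob x.1 * mob x.2 * progSum φ n A x.1 x.2 := by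
  have h1 : ∀ P ∈ monics K n, φ P * sieve N₁ P * sieve N₂ (P + A) =
      ∑ d ∈ Finset.range N₁ ×ˢ Finset.range N₂, ∑ x ∈ monics K d.1 ×ˢ monics K d.2,
        ((N₁ - d.1 : ℕ) : ℝ) * ((N₂ - d.2 : ℕ) : ℝ) * (mob x.1 * mob x.2 *
          if x.1 ∣ P ∧ x.2 ∣ P + A then φ P else 0) := by
    intro P hP
    have hPA := mem_monics.1 (add_mem_monics hP (A := A)
      ((degree_le_natDegree).trans_lt (by exact_mod_cast hA)))
    rw [sieve_eq_sum (mem_monics.1 hP).1.ne_zero, sieve_eq_sum hPA.1.ne_zero, mul_assoc,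
      Finset.sum_mul_sum, Finset.mul_sum, Finset.sum_product]
    refine Finset.sum_congr rfl fun d₁ _ => ?_
    rw [Finset.mul_sum]
    refine Finset.sum_congr rfl fun d₂ _ => ?_
    rw [Finset.sum_mul_sum, Finset.mul_sum, Finset.sum_product]
    refine Finset.sum_congr rfl fun D₁ _ => ?_
    rw [Finset.mul_sum]
    refine Finset.sum_congr rfl fun D₂ _ => ?_
    dsimp only
    by_cases ha : D₁ ∣ P <;> by_cases hb : D₂ ∣ P + A <;> (simp [ha, hb]; try ring)
  rw [Finset.sum_congr rfl h1, Finset.sum_comm]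
  refine Finset.sum_congr rfl fun d _ => ?_
  rw [Finset.sum_comm, Finset.mul_sum]
  refine Finset.sum_congr rfl fun x _ => ?_
  rw [progSum, Finset.sum_filter, Finset.mul_sum, Finset.mul_sum]

/-- The implied constant controlling how large the field has to be. -/
def fieldConst (m : ℕ) : ℕ := 2 * 4 ^ (m + 2) * (3 * m + 2 + 2 ^ (m + 4)) + 8 ^ (m + 2)

lemma sum_abs_progSum_mob_le {m d₁ d₂ : ℕ} {ε : ℝ} (hB : CharacterSumBound K (4 * (m + 2)) ε)
    (h2 : (2 : K) ≠ 0) (hqm : 2 * m ≤ Fintype.card K)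
    (hq : (fieldConst m : ℝ) ≤ ε * Fintype.card K)
    {ψ : K[X] → ℝ} (hψ : ψ = (fun _ => 1) ∨ ψ = mob) {A : K[X]} (hA : A ≠ 0)
    (hdeg : A.natDegree < m + 2) (hm : d₁ + d₂ ≤ m) :
    ∑ x ∈ monics K d₁ ×ˢ monics K d₂,
      |progSum (fun P => mob P * ψ (P + A)) (m + 2) A x.1 x.2| ≤
        6 * ε * (Fintype.card K : ℝ) ^ (m + 2) := by
  have hbad := card_filter_not_hasGoodPoint_le h2 hA hdeg hm hqm
  have hnc := mul_sum_card_not_isCoprime_le d₁ d₂ hA hdeg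
  set cnt : K[X] × K[X] → ℕ := fun x =>
    ((monics K (m + 2)).filter (fun P => x.1 ∣ P ∧ x.2 ∣ P + A)).card with hcnt
  set bad := (monics K d₁ ×ˢ monics K d₂).filter fun x : K[X] × K[X] =>
      IsCoprime x.1 x.2 ∧ ¬ HasGoodPoint m A x.1 x.2 with hbaddef
  have hqpos : (0 : ℝ) < Fintype.card K := by exact_mod_cast Fintype.card_pos
  have hε : 0 < ε := by
    have h3 : (0 : ℝ) < fieldConst m := by
      rw [fieldConst]; positivity
    exact pos_of_mul_pos_left (h3.trans_le hq) hqpos.le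
  have hq2 : 2 ≤ ε * Fintype.card K := by
    refine le_trans ?_ hq
    have h3 : 8 ^ 1 ≤ 8 ^ (m + 2) := Nat.pow_le_pow_right (by norm_num) (by omega)
    have h4 : 2 ≤ fieldConst m := by rw [fieldConst]; omega
    exact_mod_cast h4
  have hψ1 (P : K[X]) : |ψ P| ≤ 1 := by
    rcases hψ with rfl | rfl
    · simp
    · exact abs_mob_le_one P
  have hφ (P : K[X]) : |mob P * ψ (P + A)| ≤ 1 := by
    rw [abs_mul]
    exact mul_le_one₀ (abs_mob_le_one P) (abs_nonneg _) (hψ1 _)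
  have hpt : ∀ x ∈ monics K d₁ ×ˢ monics K d₂,
      |progSum (fun P => mob P * ψ (P + A)) (m + 2) A x.1 x.2| ≤
        (if ¬ IsCoprime x.1 x.2 then (cnt x : ℝ) else 0) +
        (if IsCoprime x.1 x.2 ∧ ¬ HasGoodPoint m A x.1 x.2 then
          (Fintype.card K : ℝ) ^ (m + 2 - (d₁ + d₂)) else 0) +
        4 * ε * (Fintype.card K : ℝ) ^ (m + 2 - (d₁ + d₂)) := by
    intro x hx
    obtain ⟨h₁, h₂⟩ := Finset.mem_product.1 hx
    have h5 : 0 ≤ 4 * ε * (Fintype.card K : ℝ) ^ (m + 2 - (d₁ + d₂)) := by positivity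
    by_cases hc : IsCoprime x.1 x.2
    · by_cases hg : HasGoodPoint m A x.1 x.2
      · simp only [hc, hg, not_true_eq_false, and_false, if_false, zero_add]
        exact abs_sum_filter_mob_le hB h2 hq2 hψ hdeg hc h₁ h₂ hm hg
      · simp only [hc, hg, not_true_eq_false, not_false_eq_true, and_self, if_false, zero_add,
          if_true]
        have h6 := abs_progSum_le hφ (m + 2) A x.1 x.2
        rw [card_filter_dvd_dvd hc h₁ h₂ (by omega)] at h6
        push_cast at h6
        linarith
    · simp only [hc, not_false_eq_true, if_true, false_and, if_false, add_zero]
      have h6 := abs_progSum_le hφ (m + 2) A x.1 x.2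
      linarith
  refine (Finset.sum_le_sum hpt).trans ?_
  rw [Finset.sum_add_distrib, Finset.sum_add_distrib, ← Finset.sum_filter, ← Finset.sum_filter,
    Finset.sum_const, Finset.sum_const, Finset.card_product, card_monics, card_monics,
    ← hbaddef, nsmul_eq_mul, nsmul_eq_mul]
  set q := Fintype.card K with hqdef
  have hsplit : (q : ℝ) ^ (m + 2) = (q : ℝ) ^ (d₁ + d₂) * (q : ℝ) ^ (m + 2 - (d₁ + d₂)) := by
    rw [← pow_add]
    congr 1
    omega
  have hbadR : (q : ℝ) * bad.card ≤ fieldConst m * (q : ℝ) ^ (d₁ + d₂) := by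
    have : q * bad.card ≤ fieldConst m * q ^ (d₁ + d₂) :=
      hbad.trans (Nat.mul_le_mul_right _ (Nat.le_add_right _ _))
    exact_mod_cast this
  have hncR : (q : ℝ) * (∑ x ∈ (monics K d₁ ×ˢ monics K d₂).filter
      (fun x => ¬ IsCoprime x.1 x.2), (cnt x : ℝ)) ≤ fieldConst m * (q : ℝ) ^ (m + 2) := by
    have := hnc.trans (Nat.mul_le_mul_right _
      (Nat.le_add_left (8 ^ (m + 2)) _ : _ ≤ fieldConst m))
    exact_mod_cast this
  have e1 : ∑ x ∈ (monics K d₁ ×ˢ monics K d₂).filter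
      (fun x => ¬ IsCoprime x.1 x.2), (cnt x : ℝ) ≤ ε * (q : ℝ) ^ (m + 2) := by
    refine le_of_mul_le_mul_left (hncR.trans ?_) hqpos
    calc _ ≤ (ε * q) * (q : ℝ) ^ (m + 2) := by gcongr
      _ = _ := by ring
  have e2 : (bad.card : ℝ) ≤ ε * (q : ℝ) ^ (d₁ + d₂) := by
    refine le_of_mul_le_mul_left (hbadR.trans ?_) hqpos
    calc _ ≤ (ε * q) * (q : ℝ) ^ (d₁ + d₂) := by gcongr
      _ = _ := by ring
  calc _ ≤ ε * (q : ℝ) ^ (m + 2) + ε * (q : ℝ) ^ (d₁ + d₂) * (q : ℝ) ^ (m + 2 - (d₁ + d₂)) +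
        (q : ℝ) ^ (d₁ + d₂) * (4 * ε * (q : ℝ) ^ (m + 2 - (d₁ + d₂))) := by
        rw [pow_add (q : ℝ) d₁ d₂] at e2 ⊢
        push_cast
        gcongr
    _ = _ := by rw [hsplit]; ring

end Correlations

section TwinPrimesLargeField

open scoped Classical

variable {K : Type*} [Field K] [Fintype K] [DecidableEq K]

lemma abs_weighted_sum_le {N₁ N₂ n : ℕ} (h₁ : N₁ ≤ n) (h₂ : N₂ ≤ n) {c : ℝ} (f : ℕ × ℕ → ℝ)
    (hc : 0 ≤ c) (hf : ∀ d ∈ Finset.range N₁ ×ˢ Finset.range N₂, |f d| ≤ c) :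
    |∑ d ∈ Finset.range N₁ ×ˢ Finset.range N₂,
      ((N₁ - d.1 : ℕ) : ℝ) * ((N₂ - d.2 : ℕ) : ℝ) * f d| ≤ (n : ℝ) ^ 4 * c := by
  refine (Finset.abs_sum_le_sum_abs _ _).trans ?_
  calc _ ≤ ∑ d ∈ Finset.range N₁ ×ˢ Finset.range N₂, (n : ℝ) * n * c := by
        refine Finset.sum_le_sum fun d hd => ?_
        rw [abs_mul, abs_mul, Nat.abs_cast, Nat.abs_cast]
        gcongr
        · omega
        · omega
        · exact hf d hd
    _ = (N₁ * N₂ : ℝ) * (n * n * c) := by simp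
    _ ≤ (n * n : ℝ) * (n * n * c) := by gcongr
    _ = _ := by ring

lemma abs_sum_mob_mul_sieve_le {m N₁ N₂ : ℕ} {ε : ℝ} (hε : 0 ≤ ε)
    (hB : CharacterSumBound K (4 * (m + 2)) ε)
    (h2 : (2 : K) ≠ 0) (hqm : 2 * m ≤ Fintype.card K)
    (hq : (fieldConst m : ℝ) ≤ ε * Fintype.card K)
    {ψ : K[X] → ℝ} (hψ : ψ = (fun _ => 1) ∨ ψ = mob) {A : K[X]} (hA : A ≠ 0)
    (hdeg : A.natDegree < m + 2) (hN : N₁ + N₂ ≤ m + 2) :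
    |∑ P ∈ monics K (m + 2), mob P * ψ (P + A) * sieve N₁ P * sieve N₂ (P + A)| ≤
      ((m + 2 : ℕ) : ℝ) ^ 4 * (6 * ε * (Fintype.card K : ℝ) ^ (m + 2)) := by
  rw [sum_mul_sieve_mul_sieve (fun P => mob P * ψ (P + A)) N₁ N₂ hdeg]
  refine abs_weighted_sum_le (by omega) (by omega) _ (by positivity) fun d hd => ?_
  rw [Finset.mem_product, Finset.mem_range, Finset.mem_range] at hd
  refine le_trans ?_ (sum_abs_progSum_mob_le hB h2 hqm hq hψ hA hdeg (d₁ := d.1) (d₂ := d.2)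
    (by omega))
  refine (Finset.abs_sum_le_sum_abs _ _).trans (Finset.sum_le_sum fun x _ => ?_)
  rw [abs_mul, abs_mul]
  exact mul_le_of_le_one_left (abs_nonneg _)
    (mul_le_one₀ (abs_mob_le_one _) (abs_nonneg _) (abs_mob_le_one _))

lemma abs_sum_progSum_one_sub_le {m d₁ d₂ : ℕ} {ε : ℝ}
    (hq : (fieldConst m : ℝ) ≤ ε * Fintype.card K) {A : K[X]} (hA : A ≠ 0)
    (hdeg : A.natDegree < m + 2) (hd : d₁ + d₂ ≤ m + 2) :
    |∑ x ∈ monics K d₁ ×ˢ monics K d₂, mob x.1 * mob x.2 * progSum (fun _ => 1) (m + 2) A x.1 x.2 -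
      mobMean K d₁ * mobMean K d₂ * (Fintype.card K : ℝ) ^ (m + 2)| ≤
      2 * ε * (Fintype.card K : ℝ) ^ (m + 2) := by
  have hnc := mul_sum_card_not_isCoprime_le d₁ d₂ hA hdeg
  have hpair := card_filter_not_isCoprime_pair_le (K := K) d₁ d₂
  have hqpos : (0 : ℝ) < Fintype.card K := by exact_mod_cast Fintype.card_pos
  set q := Fintype.card K with hqdef
  set cnt : K[X] × K[X] → ℕ := fun x =>
    ((monics K (m + 2)).filter (fun P => x.1 ∣ P ∧ x.2 ∣ P + A)).card with hcnt
  set h := m + 2 - (d₁ + d₂) with hh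
  have hsplit : (q : ℝ) ^ (m + 2) = (q : ℝ) ^ d₁ * (q : ℝ) ^ d₂ * (q : ℝ) ^ h := by
    rw [← pow_add, ← pow_add]
    congr 1
    omega
  have hmain : mobMean K d₁ * mobMean K d₂ * (q : ℝ) ^ (m + 2) =
      ∑ x ∈ monics K d₁ ×ˢ monics K d₂, mob x.1 * mob x.2 * (q : ℝ) ^ h := by
    rw [← Finset.sum_mul, Finset.sum_product, ← Finset.sum_mul_sum, mobMean, mobMean, hsplit,
      ← hqdef]
    field_simp
  have hpt : ∀ x ∈ monics K d₁ ×ˢ monics K d₂,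
      |mob x.1 * mob x.2 * progSum (fun _ => 1) (m + 2) A x.1 x.2 -
        mob x.1 * mob x.2 * (q : ℝ) ^ h| ≤
        if ¬ IsCoprime x.1 x.2 then (cnt x : ℝ) + (q : ℝ) ^ h else 0 := by
    intro x hx
    obtain ⟨h₁, h₂⟩ := Finset.mem_product.1 hx
    have hone : progSum (fun _ => 1) (m + 2) A x.1 x.2 = cnt x := by simp [progSum, hcnt]
    rw [hone, ← mul_sub]
    by_cases hc : IsCoprime x.1 x.2
    · rw [if_neg (not_not.2 hc), hcnt]
      dsimp only
      rw [card_filter_dvd_dvd hc h₁ h₂ hd]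
      simp [hqdef, hh]
    · rw [if_pos hc, abs_mul, abs_mul]
      refine (mul_le_of_le_one_left (abs_nonneg _)
        (mul_le_one₀ (abs_mob_le_one _) (abs_nonneg _) (abs_mob_le_one _))).trans ?_
      refine (abs_sub _ _).trans_eq ?_
      rw [Nat.abs_cast, abs_of_pos (by positivity)]
  rw [hmain, ← Finset.sum_sub_distrib]
  refine (Finset.abs_sum_le_sum_abs _ _).trans ((Finset.sum_le_sum hpt).trans ?_)
  rw [← Finset.sum_filter, Finset.sum_add_distrib, Finset.sum_const, nsmul_eq_mul]
  have hC : 8 ^ (m + 2) ≤ fieldConst m := Nat.le_add_left _ _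
  have e1 : ∑ x ∈ (monics K d₁ ×ˢ monics K d₂).filter
      (fun x => ¬ IsCoprime x.1 x.2), (cnt x : ℝ) ≤ ε * (q : ℝ) ^ (m + 2) := by
    have h1 : (q : ℝ) * (∑ x ∈ (monics K d₁ ×ˢ monics K d₂).filter
      (fun x => ¬ IsCoprime x.1 x.2), (cnt x : ℝ)) ≤ fieldConst m * (q : ℝ) ^ (m + 2) := by
      exact_mod_cast hnc.trans (Nat.mul_le_mul_right _ hC)
    refine le_of_mul_le_mul_left (h1.trans ?_) hqpos
    calc _ ≤ (ε * q) * (q : ℝ) ^ (m + 2) := by gcongr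
      _ = _ := by ring
  have e2 : (((monics K d₁ ×ˢ monics K d₂).filter (fun x => ¬ IsCoprime x.1 x.2)).card : ℝ) ≤
      ε * (q : ℝ) ^ (d₁ + d₂) := by
    have h0 : 2 ^ d₂ ≤ 8 ^ (m + 2) :=
      (Nat.pow_le_pow_left (by norm_num) _).trans (Nat.pow_le_pow_right (by norm_num) (by omega))
    have h1 : (q : ℝ) * ((monics K d₁ ×ˢ monics K d₂).filter
        (fun x => ¬ IsCoprime x.1 x.2)).card ≤ fieldConst m * (q : ℝ) ^ (d₁ + d₂) := by
      exact_mod_cast hpair.trans (Nat.mul_le_mul_right _ (h0.trans hC))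
    refine le_of_mul_le_mul_left (h1.trans ?_) hqpos
    calc _ ≤ (ε * q) * (q : ℝ) ^ (d₁ + d₂) := by gcongr
      _ = _ := by ring
  calc _ ≤ ε * (q : ℝ) ^ (m + 2) + ε * (q : ℝ) ^ (d₁ + d₂) * (q : ℝ) ^ h := by gcongr
    _ = _ := by rw [hsplit, pow_add]; ring

lemma abs_sum_sieve_mul_sieve_sub_le (hodd : Odd (Fintype.card K)) {m N : ℕ} {ε : ℝ} (hε : 0 ≤ ε)
    (hq : (fieldConst m : ℝ) ≤ ε * Fintype.card K) {A : K[X]} (hA : A ≠ 0)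
    (hdeg : A.natDegree < m + 2) (hN : 2 * N ≤ m + 2) (hN' : N + 1 ≤ m + 2) :
    |∑ P ∈ monics K (m + 2), sieve (N + 1) P * sieve (N + 1) (P + A) -
      (Fintype.card K : ℝ) ^ (m + 2)| ≤
      ((m + 2 : ℕ) : ℝ) ^ 4 * (2 * ε * (Fintype.card K : ℝ) ^ (m + 2)) := by
  have h1 := sum_mul_sieve_mul_sieve (K := K) (fun _ => 1) (N + 1) (N + 1) hdeg
  simp only [one_mul] at h1
  have h2 : (Fintype.card K : ℝ) ^ (m + 2) =
      ∑ d ∈ Finset.range (N + 1) ×ˢ Finset.range (N + 1),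
        ((N + 1 - d.1 : ℕ) : ℝ) * ((N + 1 - d.2 : ℕ) : ℝ) *
          (mobMean K d.1 * mobMean K d.2 * (Fintype.card K : ℝ) ^ (m + 2)) := by
    have h3 := sum_mul_mobMean (K := K) hodd N
    calc (Fintype.card K : ℝ) ^ (m + 2) = 1 * 1 * (Fintype.card K : ℝ) ^ (m + 2) := by ring
      _ = _ := by
        rw [← h3, Finset.sum_mul_sum, Finset.sum_product, Finset.sum_mul]
        refine Finset.sum_congr rfl fun d₁ _ => ?_
        rw [Finset.sum_mul]
        refine Finset.sum_congr rfl fun d₂ _ => ?_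
        ring
  rw [h1]
  nth_rewrite 1 [h2]
  rw [← Finset.sum_sub_distrib]
  simp only [← mul_sub]
  refine abs_weighted_sum_le hN' hN' _ (by positivity) fun d hd => ?_
  rw [Finset.mem_product, Finset.mem_range, Finset.mem_range] at hd
  exact abs_sum_progSum_one_sub_le hq hA hdeg (by omega)

/-- A weight supported on irreducible and on non-squarefree polynomials. -/
noncomputable def primeWeight (n : ℕ) (P : K[X]) : ℝ :=
  sieve ((n + 1) / 2) P - mob P * sieve (n / 2) P

lemma abs_primeWeight_le {n : ℕ} {P : K[X]} (hP : P ∈ monics K n) :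
    |primeWeight n P| ≤ 2 ^ (n + 1) * n := by
  obtain ⟨hm, hd⟩ := mem_monics.1 hP
  have h1 := abs_sieve_le ((n + 1) / 2) hm.ne_zero
  have h2 := abs_sieve_le (n / 2) hm.ne_zero
  rw [hd] at h1 h2
  have hle1 : (((n + 1) / 2 : ℕ) : ℝ) ≤ n := by exact_mod_cast (by omega : (n + 1) / 2 ≤ n)
  have hle2 : ((n / 2 : ℕ) : ℝ) ≤ n := by exact_mod_cast (by omega : n / 2 ≤ n)
  have hpow : (0 : ℝ) < 2 ^ n := by positivity
  refine (abs_sub _ _).trans ?_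
  rw [abs_mul]
  have h3 : |mob P| * |sieve (n / 2) P| ≤ |sieve (n / 2) P| :=
    mul_le_of_le_one_left (abs_nonneg _) (abs_mob_le_one _)
  rw [pow_succ]
  nlinarith

lemma card_filter_not_squarefree_pair_le {K : Type*} [Field K] [Fintype K] {n : ℕ} {A : K[X]}
    (hA : A.degree < n) :
    Fintype.card K * ((monics K n).filter
      (fun P => ¬ Squarefree P ∨ ¬ Squarefree (P + A))).card ≤ 2 * n * Fintype.card K ^ n := by
  have h1 := card_filter_not_squarefree_le (K := K) n
  have h2 : ((monics K n).filter (fun P => ¬ Squarefree (P + A))).card =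
      ((monics K n).filter (fun P => ¬ Squarefree P)).card := by
    have := sum_monics_add hA fun P => if ¬ Squarefree P then (1 : ℝ) else 0
    rw [Finset.card_filter, Finset.card_filter]
    exact_mod_cast this
  rw [Finset.filter_or]
  refine (Nat.mul_le_mul_left _ (Finset.card_union_le _ _)).trans ?_
  rw [h2]
  linarith

/-- The requirement on the size of the field for twin primes of degree `m + 2`. -/
theorem exists_twin_of_characterSumBound (hodd : Odd (Fintype.card K)) {m : ℕ} {ε : ℝ}
    (hε : 0 < ε) (hεm : 40 * ((m + 2 : ℕ) : ℝ) ^ 4 * ε ≤ 1)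
    (hB : CharacterSumBound K (4 * (m + 2)) ε) (hqm : 2 * m ≤ Fintype.card K)
    (hq : (fieldConst m : ℝ) ≤ ε * Fintype.card K)
    (hq' : 2 * ((m + 2 : ℕ) : ℝ) * (2 ^ (m + 3) * ((m + 2 : ℕ) : ℝ)) ^ 2 ≤ ε * Fintype.card K)
    {A : K[X]} (hA : A ≠ 0) (hdeg : A.natDegree < m + 2) :
    ∃ P : K[X], P.Monic ∧ P.natDegree = m + 2 ∧ Irreducible P ∧ Irreducible (P + A) := by
  by_contra! hno
  have h2 : (2 : K) ≠ 0 := Ring.two_ne_zero fun h => by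
    have := FiniteField.even_card_of_char_two h
    rw [Nat.odd_iff] at hodd
    omega
  have hqpos : (0 : ℝ) < Fintype.card K := by exact_mod_cast Fintype.card_pos
  have hAdeg : A.degree < ((m + 2 : ℕ) : WithBot ℕ) :=
    degree_le_natDegree.trans_lt (by exact_mod_cast hdeg)
  have hupper : |∑ P ∈ monics K (m + 2), primeWeight (m + 2) P * primeWeight (m + 2) (P + A)| ≤
      ε * (Fintype.card K : ℝ) ^ (m + 2) := by
    have hpt : ∀ P ∈ monics K (m + 2), |primeWeight (m + 2) P * primeWeight (m + 2) (P + A)| ≤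
        if ¬ Squarefree P ∨ ¬ Squarefree (P + A) then
          (2 ^ (m + 3) * ((m + 2 : ℕ) : ℝ)) ^ 2 else 0 := by
      intro P hP
      have hPA := add_mem_monics hP hAdeg
      split_ifs with hs
      · rw [abs_mul, sq]
        exact mul_le_mul (abs_primeWeight_le hP) (abs_primeWeight_le hPA) (abs_nonneg _)
          (by positivity)
      · push Not at hs
        rw [abs_nonpos_iff, mul_eq_zero]
        obtain ⟨hm, hd⟩ := mem_monics.1 hP
        by_cases hi : Irreducible P
        · exact Or.inr (sieve_sub_mob_mul_sieve hodd hPA (by omega) (hno P hm hd hi) hs.2)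
        · exact Or.inl (sieve_sub_mob_mul_sieve hodd hP (by omega) hi hs.1)
    refine (Finset.abs_sum_le_sum_abs _ _).trans ((Finset.sum_le_sum hpt).trans ?_)
    rw [← Finset.sum_filter, Finset.sum_const, nsmul_eq_mul]
    have hcard := card_filter_not_squarefree_pair_le hAdeg
    set s := (monics K (m + 2)).filter (fun P => ¬ Squarefree P ∨ ¬ Squarefree (P + A)) with hs
    have hcardR : (Fintype.card K : ℝ) * s.card ≤
        2 * ((m + 2 : ℕ) : ℝ) * (Fintype.card K : ℝ) ^ (m + 2) := by exact_mod_cast hcard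
    refine le_of_mul_le_mul_left ?_ hqpos
    calc (Fintype.card K : ℝ) * (s.card * (2 ^ (m + 3) * ((m + 2 : ℕ) : ℝ)) ^ 2)
        = (Fintype.card K * s.card) * (2 ^ (m + 3) * ((m + 2 : ℕ) : ℝ)) ^ 2 := by ring
      _ ≤ (2 * ((m + 2 : ℕ) : ℝ) * (Fintype.card K : ℝ) ^ (m + 2)) *
          (2 ^ (m + 3) * ((m + 2 : ℕ) : ℝ)) ^ 2 := by gcongr
      _ = (2 * ((m + 2 : ℕ) : ℝ) * (2 ^ (m + 3) * ((m + 2 : ℕ) : ℝ)) ^ 2) *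
          (Fintype.card K : ℝ) ^ (m + 2) := by ring
      _ ≤ (ε * Fintype.card K) * (Fintype.card K : ℝ) ^ (m + 2) := by gcongr
      _ = _ := by ring
  obtain ⟨N, hN⟩ : ∃ N, (m + 2 + 1) / 2 = N + 1 := ⟨(m + 1) / 2, by omega⟩
  have hmain := abs_sum_sieve_mul_sieve_sub_le hodd hε.le hq hA hdeg (N := N) (by omega) (by omega)
  rw [← hN] at hmain
  have ht1 := abs_sum_mob_mul_sieve_le hε.le hB h2 hqm hq (Or.inl rfl) hA hdeg
    (N₁ := (m + 2) / 2) (N₂ := (m + 2 + 1) / 2) (by omega)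
  have ht2 := abs_sum_mob_mul_sieve_le hε.le hB h2 hqm hq (Or.inl rfl) (neg_ne_zero.2 hA)
    (by rwa [natDegree_neg]) (N₁ := (m + 2) / 2) (N₂ := (m + 2 + 1) / 2) (by omega)
  have ht3 := abs_sum_mob_mul_sieve_le hε.le hB h2 hqm hq (Or.inr rfl) hA hdeg
    (N₁ := (m + 2) / 2) (N₂ := (m + 2) / 2) (by omega)
  rw [← sum_monics_add hAdeg] at ht2
  have hexp : ∑ P ∈ monics K (m + 2), primeWeight (m + 2) P * primeWeight (m + 2) (P + A) =
      ∑ P ∈ monics K (m + 2), sieve ((m + 2 + 1) / 2) P * sieve ((m + 2 + 1) / 2) (P + A) -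
      ∑ P ∈ monics K (m + 2), mob P * 1 * sieve ((m + 2) / 2) P *
        sieve ((m + 2 + 1) / 2) (P + A) -
      ∑ P ∈ monics K (m + 2), mob (P + A) * 1 * sieve ((m + 2) / 2) (P + A) *
        sieve ((m + 2 + 1) / 2) (P + A + -A) +
      ∑ P ∈ monics K (m + 2), mob P * mob (P + A) * sieve ((m + 2) / 2) P *
        sieve ((m + 2) / 2) (P + A) := by
    rw [← Finset.sum_sub_distrib, ← Finset.sum_sub_distrib, ← Finset.sum_add_distrib]
    refine Finset.sum_congr rfl fun P _ => ?_
    rw [add_neg_cancel_right, primeWeight, primeWeight]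
    ring
  rw [hexp] at hupper
  have hqn : (0 : ℝ) < (Fintype.card K : ℝ) ^ (m + 2) := by positivity
  have h4 : (1 : ℝ) ≤ ((m + 2 : ℕ) : ℝ) ^ 4 := one_le_pow₀
    (by push_cast; linarith [m.cast_nonneg (α := ℝ)])
  rw [abs_le] at hupper hmain ht1 ht2 ht3
  have h5 : ε * (Fintype.card K : ℝ) ^ (m + 2) ≤
      ((m + 2 : ℕ) : ℝ) ^ 4 * ε * (Fintype.card K : ℝ) ^ (m + 2) := by
    gcongr
    exact le_mul_of_one_le_left hε.le h4
  have h6 : 40 * ((m + 2 : ℕ) : ℝ) ^ 4 * ε * (Fintype.card K : ℝ) ^ (m + 2) ≤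
      1 * (Fintype.card K : ℝ) ^ (m + 2) := by gcongr
  linarith [hupper.2, hmain.1, ht1.2, ht2.2, ht3.1]

end TwinPrimesLargeField

lemma exists_twin_of_card_large (m : ℕ) : ∃ Q₀ : ℕ, ∀ (K : Type) [Field K] [Fintype K],
    Odd (Fintype.card K) → Q₀ ≤ Fintype.card K → ∀ A : K[X], A ≠ 0 → A.natDegree < m + 2 →
      ∃ P : K[X], P.Monic ∧ P.natDegree = m + 2 ∧ Irreducible P ∧ Irreducible (P + A) := by
  classical
  set ε : ℝ := 1 / (40 * ((m + 2 : ℕ) : ℝ) ^ 4) with hεdef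
  have hpos : (0 : ℝ) < 40 * ((m + 2 : ℕ) : ℝ) ^ 4 := by positivity
  have hε : 0 < ε := by positivity
  obtain ⟨Q₁, hQ₁⟩ := exists_forall_abs_sum_quadraticChar_le (4 * (m + 2)) hε
  obtain ⟨Q₂, hQ₂⟩ := exists_nat_ge ((fieldConst m : ℝ) / ε)
  obtain ⟨Q₃, hQ₃⟩ := exists_nat_ge
    (2 * ((m + 2 : ℕ) : ℝ) * (2 ^ (m + 3) * ((m + 2 : ℕ) : ℝ)) ^ 2 / ε)
  refine ⟨Q₁ + Q₂ + Q₃ + 2 * m, fun K _ _ hodd hQ A hA hdeg => ?_⟩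
  have hle {Q : ℕ} {c : ℝ} (h : c / ε ≤ Q) (hQ : Q ≤ Fintype.card K) : c ≤ ε * Fintype.card K := by
    rw [div_le_iff₀ hε] at h
    have : (Q : ℝ) ≤ Fintype.card K := by exact_mod_cast hQ
    nlinarith
  exact exists_twin_of_characterSumBound hodd hε (by rw [hεdef, mul_one_div_cancel hpos.ne'])
    (fun f hf hsq => hQ₁ K hodd (by omega) f hf hsq) (by omega) (hle hQ₂ (by omega))
    (hle hQ₃ (by omega)) hA hdeg

end TwinPrimes

/-- **Theorem 2 (twin primes in large extensions).**  Let `F_q` be a finite field of odd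
cardinality `q`, let `n` be a natural number, and let `A ∈ F_q[t]` be nonzero of degree
smaller than `n`.  Then there is `s₀` such that for every `s ≥ s₀` and every finite field
`K ⊇ F_q` with `#K = q^s`, there is a monic `P ∈ K[t]` of degree `n` with both `P` and
`P + A` irreducible over `K`. -/
theorem twin_primes_large_extension (Fq : Type) [Field Fq] [Fintype Fq]
    (hodd : Odd (Fintype.card Fq)) (n : ℕ)
    (A : Polynomial Fq) (hA : A ≠ 0) (hAdeg : A.natDegree < n) :
    ∃ s₀ : ℕ, ∀ s : ℕ, s₀ ≤ s →
      ∀ (K : Type) [Field K] [Fintype K] [Algebra Fq K],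
        Fintype.card K = Fintype.card Fq ^ s →
        ∃ P : Polynomial K, P.Monic ∧ P.natDegree = n ∧
          Irreducible P ∧ Irreducible (P + A.map (algebraMap Fq K)) := by
  obtain _ | _ | m := n
  · omega
  · refine ⟨0, fun s _ K _ _ _ _ => ⟨X, monic_X, natDegree_X, irreducible_X, ?_⟩⟩
    refine irreducible_of_degree_eq_one ?_
    rw [eq_C_of_natDegree_eq_zero (by omega : A.natDegree = 0), map_C, degree_X_add_C]
  · obtain ⟨Q₀, hQ₀⟩ := TwinPrimes.exists_twin_of_card_large m
    refine ⟨Q₀, fun s hs K _ _ _ hK => hQ₀ K (by rw [hK]; exact hodd.pow) ?_ _ ?_ ?_⟩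
    · rw [hK]
      exact hs.trans (Nat.lt_pow_self Fintype.one_lt_card).le
    · exact (Polynomial.map_ne_zero_iff (algebraMap Fq K).injective).2 hA
    · rwa [natDegree_map]
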